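/- Fix 2/3 < κ < 1 and let f : ℝ → ℝ be twice differentiable with f''(t) > 0 for all sufficiently large t and (log f''(t))/(log t) → −κ as t → ∞. Then there exists ε₀ > 0 such that for every ε with 0 < ε ≤ ε₀ there is a constant C > 0 (depending only on ε, κ and f) with the following property: for every prime p, every x, y ∈ 𝔽_p with y ≠ 0, and all real numbers K, L satisfying K^{κ−ε} ≥ L ≥ K^{κ/2}·p^{ε}, K ≤ p^{1/(2−κ)}, and L ≥ p^{1/2+ε}, one has |∑_{K < n ≤ K+L} ψ_{x,y;p}(⌊f(n)⌋ mod p)| ≤ C·L·p^{−ε²/26}, the sum being over integers n with K < n ≤ K+L. -/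

import Mathlib

/-- `ψ_{x,y;p}(u) = e_p(x·u + y·u⁻¹)` for `u ≠ 0` and `ψ_{x,y;p}(0) = 0`. -/
noncomputable def psi (p : ℕ) (x y u : ZMod p) : ℂ :=
  if u = 0 then 0
  else Complex.exp (2 * Real.pi * Complex.I * ((x * u + y * u⁻¹).val : ℂ) / (p : ℂ))

section

open Polynomial Finset

section Reduction

variable {F Ω : Type*} [Field F] [Field Ω] [Algebra F Ω]

/-- Modulo `D * (y ^ p - y) = N`, a polynomial in `y` of degree at most `2 * p - 2` reduces to one
of degree less than `p`, at the cost of one factor `D`. -/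
lemma exists_reduced_form {p : ℕ} (hp : 2 ≤ p) {D N : F[X]} {r e : ℕ} (hD : D.natDegree ≤ r)
    (hN : N.natDegree ≤ r) (z : ℕ → F[X]) (hz : ∀ m, (z m).natDegree ≤ e) :
    ∃ q : ℕ → F[X], (∀ j, (q j).natDegree ≤ e + r) ∧ ∀ x y : Ω,
      aeval x D * (y ^ p - y) = aeval x N →
      aeval x D * ∑ m ∈ range (2 * p - 1), aeval x (z m) * y ^ m =
        ∑ j ∈ range p, aeval x (q j) * y ^ j := by
  obtain ⟨n, rfl⟩ : ∃ n, p = n + 1 := ⟨p - 1, by omega⟩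
  have hmul : ∀ {A B : F[X]}, A.natDegree ≤ e → B.natDegree ≤ r → (B * A).natDegree ≤ e + r :=
    fun {A B} hA hB => natDegree_mul_le.trans (by omega)
  refine ⟨fun j => D * z j + ((if j = 0 then 0 else D * z (j + n)) +
    (if j = n then 0 else N * z (j + n + 1))), fun j => ?_, fun x y h => ?_⟩
  · refine natDegree_add_le_of_degree_le (hmul (hz _) hD)
      (natDegree_add_le_of_degree_le ?_ ?_)
    · split_ifs
      · simp
      · exact hmul (hz _) hD
    · split_ifs
      · simp
      · exact hmul (hz _) hN
  · have h2 : 2 * (n + 1) - 1 = (n + 1) + n := by omega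
    rw [h2, sum_range_add, mul_add]
    simp only [map_add, add_mul, sum_add_distrib]
    congr 1
    · rw [mul_sum]
      refine sum_congr rfl fun j _ => ?_
      rw [map_mul]; ring
    · have e1 : ∑ j ∈ range (n + 1), aeval x (if j = 0 then 0 else D * z (j + n)) * y ^ j =
          ∑ j ∈ range n, aeval x D * aeval x (z (n + 1 + j)) * y ^ (j + 1) := by
        rw [sum_range_succ']
        simp [add_comm, add_left_comm]
      have e2 : ∑ j ∈ range (n + 1), aeval x (if j = n then 0 else N * z (j + n + 1)) * y ^ j =
          ∑ j ∈ range n, aeval x N * aeval x (z (n + 1 + j)) * y ^ j := by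
        rw [sum_range_succ]
        simp only [if_true, map_zero, zero_mul, add_zero]
        refine sum_congr rfl fun j hj => ?_
        rw [if_neg (mem_range.1 hj).ne, map_mul]
        congr 4
        ring
      rw [e1, e2, ← sum_add_distrib, mul_sum]
      refine sum_congr rfl fun j _ => ?_
      rw [← h]
      ring

/-- The functions `y ^ l * (y + T / D ^ P + τ) ^ j` on the curve `D * (y ^ p - y) = N` have
polynomial coordinates in the basis `1, y, …, y ^ (p - 1)` after multiplication by a fixed power
of `D`. -/
lemma exists_reduced_mul_pow {p : ℕ} (hp : 2 ≤ p) {D N : F[X]} {r P a : ℕ}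
    (hD : D.natDegree ≤ r) (hN : N.natDegree ≤ r) (T : F[X]) (hT : T.natDegree ≤ r * P)
    (g : F[X]) (hg : g.natDegree ≤ a) (τ : F) {l j : ℕ} (hl : l < p) (hj : j < p) :
    ∃ q : ℕ → F[X], (∀ i, (q i).natDegree ≤ a + r * ((p - 1) * P + 1)) ∧ ∀ x y : Ω,
      aeval x D ≠ 0 → aeval x D * (y ^ p - y) = aeval x N →
      aeval x D ^ ((p - 1) * P + 1) *
          (aeval x g * (y ^ l * (y + (aeval x T / aeval x D ^ P + algebraMap F Ω τ)) ^ j)) =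
        ∑ i ∈ range p, aeval x (q i) * y ^ i := by
  set U : F[X] := T + C τ * D ^ P with hU
  have hDP : ∀ k, (D ^ k).natDegree ≤ r * k := fun k =>
    natDegree_pow_le.trans (by rw [mul_comm]; exact Nat.mul_le_mul_right _ hD)
  have hUd : U.natDegree ≤ r * P := by
    refine natDegree_add_le_of_degree_le hT ?_
    exact (natDegree_C_mul_le _ _).trans (hDP P)
  set z : ℕ → F[X] := fun m => ∑ i ∈ range (j + 1), if l + i = m then
    C ((j.choose i : ℕ) : F) * (g * (U ^ (j - i) * D ^ ((p - 1 - (j - i)) * P))) else 0 with hz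
  have hzd : ∀ m, (z m).natDegree ≤ a + r * ((p - 1) * P) := by
    intro m
    refine natDegree_sum_le_of_forall_le _ _ fun i hi => ?_
    split_ifs
    · refine (natDegree_C_mul_le _ _).trans (natDegree_mul_le.trans (add_le_add hg ?_))
      refine natDegree_mul_le.trans ((add_le_add natDegree_pow_le (hDP _)).trans ?_)
      have h1 : (j - i) * U.natDegree ≤ (j - i) * (r * P) := Nat.mul_le_mul_left _ hUd
      have h2 : (p - 1) = (j - i) + (p - 1 - (j - i)) := by omega
      calc _ ≤ (j - i) * (r * P) + r * ((p - 1 - (j - i)) * P) := by omega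
        _ = r * (((j - i) + (p - 1 - (j - i))) * P) := by ring
        _ = _ := by rw [← h2]
    · simp
  obtain ⟨q, hq, hq'⟩ := exists_reduced_form (Ω := Ω) hp hD hN z hzd
  refine ⟨q, fun i => (hq i).trans (by rw [mul_add, mul_one]; omega), fun x y hx h => ?_⟩
  rw [← hq' x y h, pow_succ', mul_assoc]
  congr 1
  have hUx : aeval x T / aeval x D ^ P + algebraMap F Ω τ = aeval x U / aeval x D ^ P := by
    rw [hU]
    simp only [map_add, map_mul, map_pow, aeval_C]
    field_simp
  rw [hUx, add_pow]
  simp only [hz, map_sum, sum_mul]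
  rw [sum_comm, mul_sum, mul_sum, mul_sum]
  refine sum_congr rfl fun i hi => ?_
  have hi' : i ≤ j := by simpa [Nat.lt_succ_iff] using hi
  rw [sum_eq_single (l + i)]
  · simp only [if_true, map_mul, map_pow, map_natCast]
    have h2 : (p - 1) * P = P * (j - i) + (p - 1 - (j - i)) * P := by
      have : (p - 1) = (j - i) + (p - 1 - (j - i)) := by omega
      conv_lhs => rw [this]
      ring
    rw [div_pow, ← pow_mul, h2, pow_add, pow_add]
    field_simp
  · intro m _ hm
    rw [if_neg (Ne.symm hm)]; simp
  · intro hm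
    exfalso; apply hm; rw [mem_range]; omega

end Reduction

section Place

variable {F Ω : Type*} [Field F] [Field Ω] [Algebra F Ω]

/-- The rational function `∑ c_b / (b - v)` with simple poles at the points of `S`. -/
def poleSum (S : Finset F) (c : F → F) (v : Ω) : Ω :=
  ∑ b ∈ S, algebraMap F Ω (c b) / (algebraMap F Ω b - v)

/-- There is a valuation, trivial on constants, for which `x` is transcendental and small. -/
lemma exists_valuationSubring_of_transcendental {x : Ω} (hx : Transcendental F x) :
    ∃ V : ValuationSubring Ω, (∀ a : F, a ≠ 0 → V.valuation (algebraMap F Ω a) = 1) ∧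
      V.valuation x < 1 := by
  let A : Subring Ω := (Algebra.adjoin F {x}).toSubring
  have hxA : x ∈ A := Algebra.self_mem_adjoin_singleton F x
  let I : Ideal A := Ideal.span {⟨x, hxA⟩}
  have hI : I ≠ ⊤ := by
    intro h
    rw [Ideal.eq_top_iff_one, Ideal.mem_span_singleton] at h
    obtain ⟨⟨z, hz⟩, hz'⟩ := h
    have hz2 : z ∈ Algebra.adjoin F {x} := hz
    rw [Algebra.adjoin_singleton_eq_range_aeval] at hz2
    obtain ⟨g, rfl⟩ := hz2
    have h1 : (1 : Ω) = x * aeval x g := congrArg Subtype.val hz'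
    have h2 : aeval x (X * g - 1) = 0 := by simp [← h1]
    rw [transcendental_iff] at hx
    have h3 := congrArg (eval 0) (hx _ h2)
    simp at h3
  obtain ⟨V, hV, hVI⟩ := Ideal.image_subset_nonunits_valuationSubring I hI
  have hle : ∀ a : F, V.valuation (algebraMap F Ω a) ≤ 1 := fun a => by
    rw [ValuationSubring.valuation_le_one_iff]
    exact hV ((Algebra.adjoin F {x}).algebraMap_mem a)
  refine ⟨V, fun a ha => le_antisymm (hle a) ?_, ?_⟩
  · have h1 := hle a⁻¹
    rw [map_inv₀, map_inv₀] at h1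
    have h0 : V.valuation (algebraMap F Ω a) ≠ 0 := by simpa using ha
    exact (inv_le_one₀ (zero_lt_iff.2 h0)).1 h1
  · have : x ∈ V.nonunits := hVI ⟨⟨x, hxA⟩, Ideal.subset_span rfl, rfl⟩
    exact (ValuationSubring.mem_nonunits_iff V).1 this

lemma exists_point_valuation [IsAlgClosed Ω] {p : ℕ} (hp : 2 ≤ p) {S : Finset F} {c : F → F}
    {b₀ : F} (hb₀ : b₀ ∈ S) (hc : c b₀ ≠ 0) (hΩ : ∃ x : Ω, Transcendental F x) :
    ∃ (x y : Ω) (V : ValuationSubring Ω), (∀ b ∈ S, algebraMap F Ω b - x ≠ 0) ∧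
      y ^ p - y = poleSum S c x ∧
      (∀ a : F, a ≠ 0 → V.valuation (algebraMap F Ω a) = 1) ∧
      1 < V.valuation y ∧ V.valuation (x - algebraMap F Ω b₀) * V.valuation y ^ p = 1 := by
  classical
  obtain ⟨w, hw⟩ := hΩ
  obtain ⟨V, hV, hVw⟩ := exists_valuationSubring_of_transcendental hw
  set v := V.valuation with hv
  have hw0 : w ≠ 0 := fun h => by
    rw [h] at hw; exact hw (isAlgebraic_zero)
  have hvw0 : 0 < v w := zero_lt_iff.2 (by simpa using hw0)
  set x : Ω := w + algebraMap F Ω b₀ with hx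
  have hxb : ∀ b : F, b ≠ b₀ → v (algebraMap F Ω b - x) = 1 := by
    intro b hb
    have h1 : algebraMap F Ω b - x = algebraMap F Ω (b - b₀) - w := by
      rw [hx, map_sub]; ring
    have h2 := hV (b - b₀) (sub_ne_zero.2 hb)
    rw [h1, Valuation.map_sub_eq_of_lt_left _ (by rw [h2]; exact hVw), h2]
  have hxb₀ : algebraMap F Ω b₀ - x = -w := by rw [hx]; ring
  obtain ⟨y, hy⟩ : ∃ y : Ω, y ^ p - y = poleSum S c x := by
    have hdeg : (X ^ p - X - C (poleSum S c x) : Polynomial Ω).degree ≠ 0 := by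
      have : (X ^ p - X - C (poleSum S c x) : Polynomial Ω).natDegree = p := by
        rw [natDegree_sub_C, FiniteField.X_pow_card_sub_X_natDegree_eq Ω (by omega)]
      intro h
      have h0 := natDegree_eq_of_degree_eq_some (n := 0) h
      omega
    obtain ⟨y, hy⟩ := IsAlgClosed.exists_root _ hdeg
    refine ⟨y, ?_⟩
    simpa [IsRoot, sub_eq_zero] using hy
  have hR : v (poleSum S c x) = (v w)⁻¹ := by
    have hterm : v (algebraMap F Ω (c b₀) / (algebraMap F Ω b₀ - x)) = (v w)⁻¹ := by
      rw [map_div₀, hV _ hc, hxb₀, Valuation.map_neg, one_div]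
    have h1 : (1 : V.ValueGroup) < (v w)⁻¹ := (one_lt_inv₀ hvw0).2 hVw
    unfold poleSum
    rw [Valuation.map_sum_eq_of_lt v hb₀, hterm]
    intro b hb
    have hb' : b ≠ b₀ := by simp at hb; exact hb.2
    rw [hterm, map_div₀, hxb b hb', div_one]
    refine lt_of_le_of_lt ?_ h1
    by_cases h : c b = 0
    · simp [h]
    · exact (hV _ h).le
  have hvR : 1 < v (poleSum S c x) := by rw [hR]; exact (one_lt_inv₀ hvw0).2 hVw
  have hy1 : 1 < v y := by
    by_contra h
    push Not at h
    rw [← hy] at hvR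
    exact absurd (Valuation.map_sub_le v (by rw [map_pow]; exact pow_le_one₀ zero_le h) h)
      (not_le.2 hvR)
  have hyp : v y ^ p = (v w)⁻¹ := by
    rw [← hR, ← hy, Valuation.map_sub_eq_of_lt_left, map_pow]
    rw [map_pow]
    exact lt_self_pow₀ hy1 (by omega)
  refine ⟨x, y, V, fun b hb => ?_, hy, hV, hy1, ?_⟩
  · by_cases h : b = b₀
    · rw [h, hxb₀]; simpa using hw0
    · intro h0
      have := hxb b h
      rw [h0] at this
      simp at this
  · have : x - algebraMap F Ω b₀ = w := by rw [hx]; ring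
    rw [this, hyp, mul_inv_cancel₀ hvw0.ne']

end Place

section Stepanov

variable {F Ω : Type*} [Field F] [Field Ω] [Algebra F Ω]

lemma monomial_exponent_injective {p P : ℕ} {i j k l i' j' k' l' : ℕ} (hi : i < P) (hi' : i' < P)
    (hj : j < p) (hj' : j' < p) (hl : l < p) (hl' : l' < p)
    (h : (j + l * (p * P) : ℤ) - p * (i + k * (p * P)) =
      (j' + l' * (p * P) : ℤ) - p * (i' + k' * (p * P))) :
    i = i' ∧ j = j' ∧ k = k' ∧ l = l' := by
  have digit : ∀ {m a a' : ℕ} {z z' : ℤ}, a < m → a' < m → (a : ℤ) + m * z = a' + m * z' →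
      a = a' ∧ z = z' := by
    intro m a a' z z' ha ha' h
    have hd : (m : ℤ) ∣ a - a' := ⟨z' - z, by linear_combination h⟩
    have h0 : (a : ℤ) - a' = 0 := Int.eq_zero_of_abs_lt_dvd hd (by rw [abs_lt]; omega)
    have : a = a' := by omega
    subst this
    refine ⟨rfl, ?_⟩
    have hm : (m : ℤ) ≠ 0 := by omega
    exact mul_left_cancel₀ hm (by linear_combination h)
  obtain ⟨rfl, h1⟩ := digit (z := (l * P : ℤ) - (i + k * (p * P)))
    (z' := (l' * P : ℤ) - (i' + k' * (p * P))) hj hj' (by linear_combination h)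
  obtain ⟨rfl, h2⟩ := digit (z := (k * p : ℤ) - l) (z' := (k' * p : ℤ) - l') hi hi'
    (by linear_combination -h1)
  obtain ⟨rfl, h3⟩ := digit (z := -(k : ℤ)) (z' := -(k' : ℤ)) hl hl' (by linear_combination -h2)
  exact ⟨rfl, rfl, by omega, rfl⟩

/-- The monomials `x ^ (i + p P k) y ^ (j + p P l)` have distinct valuations at a place where
`x y ^ p` is a unit and `y` is large, hence they are linearly independent. -/
lemma sum_monomials_ne_zero {p P B : ℕ} {x y : Ω} (V : ValuationSubring Ω)
    (hV : ∀ a : F, a ≠ 0 → V.valuation (algebraMap F Ω a) = 1) (hy : 1 < V.valuation y)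
    (hxy : V.valuation x * V.valuation y ^ p = 1)
    (w : Fin P × Fin p × Fin B × Fin p → F) (hw : w ≠ 0) :
    ∑ d, algebraMap F Ω (w d) * (x ^ (d.1 + (p * P) * d.2.2.1 : ℕ) *
      (y ^ (d.2.1 : ℕ) * (y ^ (p * P)) ^ (d.2.2.2 : ℕ))) ≠ 0 := by
  classical
  set v := V.valuation with hv
  let e : Fin P × Fin p × Fin B × Fin p → ℤ := fun d =>
    ((d.2.1 : ℕ) + (d.2.2.2 : ℕ) * (p * P) : ℤ) - p * ((d.1 : ℕ) + (d.2.2.1 : ℕ) * (p * P))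
  have he : Function.Injective e := by
    rintro ⟨i, j, k, l⟩ ⟨i', j', k', l'⟩ h
    obtain ⟨h1, h2, h3, h4⟩ :=
      monomial_exponent_injective i.2 i'.2 j.2 j'.2 l.2 l'.2 h
    exact Prod.ext (Fin.ext h1) (Prod.ext (Fin.ext h2) (Prod.ext (Fin.ext h3) (Fin.ext h4)))
  have hy0 : v y ≠ 0 := (zero_lt_one.trans hy).ne'
  have hx : v x = v y ^ (-(p : ℤ)) := by
    rw [zpow_neg, zpow_natCast]; exact eq_inv_of_mul_eq_one_left hxy
  have hterm : ∀ d, w d ≠ 0 → v (algebraMap F Ω (w d) * (x ^ (d.1 + (p * P) * d.2.2.1 : ℕ) *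
      (y ^ (d.2.1 : ℕ) * (y ^ (p * P)) ^ (d.2.2.2 : ℕ)))) = v y ^ e d := by
    intro d hd
    simp only [map_mul, map_pow, hV _ hd, one_mul, hx]
    simp only [← zpow_natCast, ← zpow_mul, ← zpow_add₀ hy0]
    congr 1
    simp only [e]
    push_cast
    ring
  obtain ⟨d₁, hd₁⟩ := Function.ne_iff.1 hw
  obtain ⟨d₀, hd₀, hmax⟩ := exists_max_image (univ.filter fun d => w d ≠ 0) e
    ⟨d₁, by simpa using hd₁⟩
  have hd₀' : w d₀ ≠ 0 := by simpa using hd₀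
  intro h0
  have hsum := Valuation.map_sum_eq_of_lt v (mem_univ d₀) (f := fun d =>
    algebraMap F Ω (w d) * (x ^ (d.1 + (p * P) * d.2.2.1 : ℕ) *
      (y ^ (d.2.1 : ℕ) * (y ^ (p * P)) ^ (d.2.2.2 : ℕ)))) ?_
  · rw [h0, hterm _ hd₀', map_zero] at hsum
    exact zpow_ne_zero _ hy0 hsum.symm
  · intro d hd
    simp only [mem_sdiff, mem_univ, mem_singleton, true_and] at hd
    rw [hterm _ hd₀']
    by_cases hwd : w d = 0
    · simp only [hwd, map_zero, zero_mul]
      exact zero_lt_iff.2 (zpow_ne_zero _ hy0)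
    · rw [hterm _ hwd]
      refine zpow_lt_zpow_right₀ hy (lt_of_le_of_ne (hmax d (by simpa using hwd)) ?_)
      exact fun h => hd (he h)

variable (S : Finset F) (c : F → F)

/-- The denominator of `poleSum S c`. -/
noncomputable def poleDenom : F[X] := ∏ b ∈ S, (C b - X)

open Classical in
/-- The numerator of `poleSum S c`. -/
noncomputable def poleNumer : F[X] := ∑ b ∈ S, C (c b) * ∏ b' ∈ S.erase b, (C b' - X)

lemma natDegree_prod_C_sub_X_le (s : Finset F) :
    (∏ b ∈ s, (C b - X : F[X])).natDegree ≤ #s := by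
  refine (natDegree_prod_le _ _).trans ?_
  rw [card_eq_sum_ones]
  refine sum_le_sum fun b _ => ?_
  exact (natDegree_sub_le _ _).trans (by simp)

lemma natDegree_poleDenom_le : (poleDenom S).natDegree ≤ #S := natDegree_prod_C_sub_X_le S

lemma natDegree_poleNumer_le : (poleNumer S c).natDegree ≤ #S := by
  classical
  refine natDegree_sum_le_of_forall_le _ _ fun b _ => ?_
  exact (natDegree_C_mul_le _ _).trans
    ((natDegree_prod_C_sub_X_le _).trans (card_le_card (erase_subset _ _)))

variable {S}

lemma aeval_poleDenom_ne_zero {x : Ω} (hx : ∀ b ∈ S, algebraMap F Ω b - x ≠ 0) :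
    aeval x (poleDenom S) ≠ 0 := by
  simpa [poleDenom, map_prod, prod_ne_zero_iff] using hx

lemma aeval_poleNumer {x : Ω} (hx : ∀ b ∈ S, algebraMap F Ω b - x ≠ 0) :
    aeval x (poleNumer S c) = aeval x (poleDenom S) * poleSum S c x := by
  classical
  simp only [poleNumer, poleDenom, poleSum, map_sum, map_mul, map_prod, map_sub, aeval_C, aeval_X,
    mul_sum]
  refine sum_congr rfl fun b hb => ?_
  rw [← mul_prod_erase S _ hb]
  have := hx b hb
  field_simp

end Stepanov

section Frobenius

variable {p : ℕ} [Fact p.Prime] {Ω : Type*} [Field Ω] [Algebra (ZMod p) Ω]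
  {S : Finset (ZMod p)} (c : ZMod p → ZMod p)

lemma algebraMap_zmod_pow (a : ZMod p) (j : ℕ) :
    algebraMap (ZMod p) Ω a ^ p ^ j = algebraMap (ZMod p) Ω a := by
  rw [← map_pow, ZMod.pow_card_pow]

variable (S) in
lemma poleSum_pow (v : Ω) (j : ℕ) : poleSum S c v ^ p ^ j = poleSum S c (v ^ p ^ j) := by
  have : CharP Ω p := charP_of_injective_algebraMap (algebraMap (ZMod p) Ω).injective p
  simp only [poleSum]
  rw [sum_pow_char_pow]
  refine sum_congr rfl fun b _ => ?_
  rw [div_pow, sub_pow_char_pow, algebraMap_zmod_pow, algebraMap_zmod_pow]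

variable (S) in
/-- The sum of the first `n` Frobenius conjugates of `poleSum S c v`. -/
def poleTrace (n : ℕ) (v : Ω) : Ω := ∑ j ∈ range n, poleSum S c v ^ p ^ j

lemma pow_eq_add_poleTrace {v y : Ω} (h : y ^ p - y = poleSum S c v) (n : ℕ) :
    y ^ p ^ n = y + poleTrace S c n v := by
  have : CharP Ω p := charP_of_injective_algebraMap (algebraMap (ZMod p) Ω).injective p
  induction n with
  | zero => simp [poleTrace]
  | succ n ih =>
    rw [pow_succ, pow_mul, ih, add_pow_char]
    simp only [poleTrace]
    rw [sum_pow_char, sum_range_succ', ← h]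
    simp only [← pow_mul, ← pow_succ]
    ring

variable (S) in
lemma poleTrace_add (m n : ℕ) (v : Ω) :
    poleTrace S c (m + n) v = poleTrace S c m v + poleTrace S c n (v ^ p ^ m) := by
  simp only [poleTrace, sum_range_add, ← poleSum_pow]
  congr 1
  refine sum_congr rfl fun j _ => ?_
  rw [← pow_mul, ← pow_add]

variable (S) in
/-- The numerator of `poleTrace S c μ` over the denominator `poleDenom S ^ p ^ (μ - 1)`. -/
noncomputable def poleTraceNumer (μ : ℕ) : (ZMod p)[X] :=
  ∑ j ∈ range μ, poleNumer S c ^ p ^ j * poleDenom S ^ (p ^ (μ - 1) - p ^ j)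

lemma natDegree_poleTraceNumer_le (μ : ℕ) :
    (poleTraceNumer S c μ).natDegree ≤ #S * p ^ (μ - 1) := by
  refine natDegree_sum_le_of_forall_le _ _ fun j hj => ?_
  have hj' : p ^ j ≤ p ^ (μ - 1) := Nat.pow_le_pow_right (Fact.out : p.Prime).pos
    (by have := mem_range.1 hj; omega)
  refine natDegree_mul_le.trans ((add_le_add natDegree_pow_le natDegree_pow_le).trans ?_)
  calc _ ≤ p ^ j * #S + (p ^ (μ - 1) - p ^ j) * #S := by
        gcongr
        · exact natDegree_poleNumer_le S c
        · exact natDegree_poleDenom_le S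
    _ = (p ^ j + (p ^ (μ - 1) - p ^ j)) * #S := by ring
    _ = _ := by rw [Nat.add_sub_cancel' hj', mul_comm]

lemma aeval_poleTraceNumer {v : Ω} (hv : ∀ b ∈ S, algebraMap (ZMod p) Ω b - v ≠ 0) (μ : ℕ) :
    aeval v (poleTraceNumer S c μ) / aeval v (poleDenom S) ^ p ^ (μ - 1) = poleTrace S c μ v := by
  rw [div_eq_iff (pow_ne_zero _ (aeval_poleDenom_ne_zero hv)), poleTrace, poleTraceNumer,
    map_sum, sum_mul]
  refine sum_congr rfl fun j hj => ?_
  have hj' : p ^ j ≤ p ^ (μ - 1) := Nat.pow_le_pow_right (Fact.out : p.Prime).pos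
    (by have := mem_range.1 hj; omega)
  rw [map_mul, map_pow, map_pow, aeval_poleNumer c hv, mul_pow, mul_right_comm, ← pow_add,
    Nat.add_sub_cancel' hj', mul_comm]

lemma stepanov_dimension_count {r μ : ℕ} (hr : r ≤ p) (hμ : 2 ≤ μ) :
    p * (p * p ^ (μ - 1) * (p ^ (μ - 1) - 1) + (p ^ (μ - 1) + r) +
      r * ((p - 1) * p ^ (μ - 1) + 1) + 1) <
    p ^ (μ - 1) * (p * ((p ^ (μ - 1) + r + 1) * p)) := by
  have hp : 2 ≤ p := (Fact.out : p.Prime).two_le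
  have hP : p ≤ p ^ (μ - 1) := Nat.le_self_pow (by omega) p
  set P := p ^ (μ - 1)
  obtain ⟨P', hP'⟩ : ∃ P', P = P' + 1 := ⟨P - 1, by omega⟩
  obtain ⟨p', hp'⟩ : ∃ p', p = p' + 1 := ⟨p - 1, by omega⟩
  have e1 : P - 1 = P' := by omega
  have e2 : p - 1 = p' := by omega
  rw [e1, e2]
  have key : p * P * P' + (P + r) + r * (p' * P + 1) + 1 < P * ((P + r + 1) * p) := by
    have h1 : p * P * P' + p * P = P * P * p := by rw [hP']; ring
    have h2 : r * (p' * P + 1) ≤ r * (p * P) := by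
      apply Nat.mul_le_mul_left; rw [hp', add_mul, one_mul]; omega
    have h3 : P * ((P + r + 1) * p) = P * P * p + r * (p * P) + p * P := by ring
    have h4 : 2 * P ≤ p * P := Nat.mul_le_mul_right _ hp
    omega
  calc _ < p * (P * ((P + r + 1) * p)) := by
        apply Nat.mul_lt_mul_of_pos_left key; omega
    _ = _ := by ring

/-- The Stepanov bound for the number of points `v` of the field with `p ^ (2 * μ)` elements at
which the trace of `poleSum S c v` takes a given value. -/
theorem card_poleTrace_eq_le [IsAlgClosed Ω] (hΩ : ∃ x : Ω, Transcendental (ZMod p) x)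
    (hS : S.Nonempty) (hc : ∀ b ∈ S, c b ≠ 0) {μ : ℕ} (hμ : 2 ≤ μ) (t : ZMod p) (T : Finset Ω)
    (hT : ∀ v ∈ T, v ^ p ^ (2 * μ) = v ∧ (∀ b ∈ S, algebraMap (ZMod p) Ω b - v ≠ 0) ∧
      poleTrace S c (2 * μ) v = algebraMap (ZMod p) Ω t) :
    #T ≤ p ^ (2 * μ - 1) + (2 * #S + 1) * p ^ μ := by
  classical
  have hchar : CharP Ω p := charP_of_injective_algebraMap (algebraMap (ZMod p) Ω).injective p
  have hp : 2 ≤ p := (Fact.out : p.Prime).two_le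
  obtain ⟨b₀, hb₀⟩ := hS
  set r := #S with hr
  have hrp : r ≤ p := by simpa [ZMod.card] using card_le_univ S
  set P := p ^ (μ - 1) with hP
  have hPp : p * P = p ^ μ := by rw [hP, ← pow_succ']; congr 1; omega
  have hPpos : 0 < P := by positivity
  set B := P + r + 1 with hB
  set D := poleDenom S
  set N := poleNumer S c
  have hcurve : ∀ {x y : Ω}, (∀ b ∈ S, algebraMap (ZMod p) Ω b - x ≠ 0) →
      y ^ p - y = poleSum S c x → aeval x D * (y ^ p - y) = aeval x N := fun hx h => by
    rw [h, aeval_poleNumer c hx]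
  have rep := fun (a : ℕ) (g : (ZMod p)[X]) (hg : g.natDegree ≤ a) (τ : ZMod p) (l j : Fin p) =>
    exists_reduced_mul_pow (Ω := Ω) hp (natDegree_poleDenom_le S) (natDegree_poleNumer_le S c)
    (poleTraceNumer S c μ) (natDegree_poleTraceNumer_le c μ) g hg τ l.2 j.2
  have hdeg : ∀ e : ℕ, ((X - C b₀ : (ZMod p)[X]) ^ e).natDegree ≤ e := fun e => by
    simp
  let ι := Fin P × Fin p × Fin B × Fin p
  let a₁ := p * P * (P - 1) + (P + r)
  let a₂ := (P - 1) + p * P * (P + r)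
  have hd₁ : ∀ d : ι, ((X - C b₀ : (ZMod p)[X]) ^ (p * P * d.1 + d.2.2.1 : ℕ)).natDegree ≤ a₁ := by
    intro d
    refine (hdeg _).trans (add_le_add (Nat.mul_le_mul_left _ ?_) ?_)
    · have := d.1.2; omega
    · have := d.2.2.1.2; omega
  have hd₂ : ∀ d : ι, ((X - C b₀ : (ZMod p)[X]) ^ (d.1 + p * P * d.2.2.1 : ℕ)).natDegree ≤ a₂ := by
    intro d
    refine (hdeg _).trans (add_le_add ?_ (Nat.mul_le_mul_left _ ?_))
    · have := d.1.2; omega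
    · have := d.2.2.1.2; omega
  choose q₁ hq₁ hq₁' using fun d : ι => rep a₁ _ (hd₁ d) (-t) d.2.2.2 d.2.1
  choose q₂ hq₂ hq₂' using fun d : ι => rep a₂ _ (hd₂ d) 0 d.2.1 d.2.2.2
  set M := r * ((p - 1) * P + 1) with hM
  -- the linear system
  let Φ : (ι → ZMod p) →ₗ[ZMod p] (Fin p × Fin (a₁ + M + 1) → ZMod p) :=
    Fintype.linearCombination (ZMod p) fun d u => (q₁ d u.1).coeff u.2
  have hker : LinearMap.ker Φ ≠ ⊥ := by
    apply LinearMap.ker_ne_bot_of_finrank_lt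
    simp only [Module.finrank_fintype_fun_eq_card, ι, Fintype.card_prod, Fintype.card_fin]
    exact stepanov_dimension_count hrp hμ
  obtain ⟨w, hwker, hw⟩ := Submodule.exists_mem_ne_zero_of_ne_bot hker
  have hq₁0 : ∀ j < p, ∑ d, C (w d) * q₁ d j = 0 := by
    intro j hj
    ext n
    rw [coeff_zero, finsetSum_coeff]
    simp only [coeff_C_mul]
    by_cases hn : n < a₁ + M + 1
    · have := congrFun (LinearMap.mem_ker.1 hwker) (⟨j, hj⟩, ⟨n, hn⟩)
      simpa [Φ, Fintype.linearCombination_apply, Finset.sum_apply] using this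
    · refine sum_eq_zero fun d _ => ?_
      rw [coeff_eq_zero_of_natDegree_lt, mul_zero]
      have := hq₁ d j
      omega
  let H : ℕ → (ZMod p)[X] := fun j => ∑ d, C (w d) * q₂ d j
  have hHdeg : ∀ j, (H j).natDegree ≤ a₂ + M := fun j =>
    natDegree_sum_le_of_forall_le _ _ fun d _ => (natDegree_C_mul_le _ _).trans (hq₂ d j)
  -- the auxiliary function in the two forms
  have hrel : ∀ {x y : Ω}, (∀ b ∈ S, algebraMap (ZMod p) Ω b - x ≠ 0) →
      y ^ p - y = poleSum S c x →
      ∑ d, algebraMap (ZMod p) Ω (w d) *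
        ((x - algebraMap (ZMod p) Ω b₀) ^ (p * P * d.1 + d.2.2.1 : ℕ) * (y ^ (d.2.2.2 : ℕ) *
          (y + (poleTrace S c μ x - algebraMap (ZMod p) Ω t)) ^ (d.2.1 : ℕ))) = 0 := by
    intro x y hx hxy
    have hD := aeval_poleDenom_ne_zero hx
    refine (mul_eq_zero.1 ?_).resolve_left (pow_ne_zero ((p - 1) * P + 1) hD)
    rw [mul_sum]
    have e1 : ∀ d : ι, aeval x (poleDenom S) ^ ((p - 1) * P + 1) * (algebraMap (ZMod p) Ω (w d) *
        ((x - algebraMap (ZMod p) Ω b₀) ^ (p * P * d.1 + d.2.2.1 : ℕ) * (y ^ (d.2.2.2 : ℕ) *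
          (y + (poleTrace S c μ x - algebraMap (ZMod p) Ω t)) ^ (d.2.1 : ℕ)))) =
        ∑ j ∈ range p, aeval x (C (w d) * q₁ d j) * y ^ j := by
      intro d
      have := hq₁' d x y hD (hcurve hx hxy)
      rw [aeval_poleTraceNumer c hx, map_pow, map_sub, aeval_X, aeval_C, map_neg,
        ← sub_eq_add_neg] at this
      rw [mul_left_comm, this, mul_sum]
      refine sum_congr rfl fun j _ => ?_
      rw [map_mul, aeval_C, mul_assoc]
    rw [sum_congr rfl fun d _ => e1 d, sum_comm]
    refine sum_eq_zero fun j hj => ?_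
    rw [← sum_mul, ← map_sum, hq₁0 j (mem_range.1 hj), map_zero, zero_mul]
  have hH : ∀ {x y : Ω}, (∀ b ∈ S, algebraMap (ZMod p) Ω b - x ≠ 0) →
      y ^ p - y = poleSum S c x →
      aeval x D ^ ((p - 1) * P + 1) * ∑ d, algebraMap (ZMod p) Ω (w d) *
        ((x - algebraMap (ZMod p) Ω b₀) ^ (d.1 + p * P * d.2.2.1 : ℕ) * (y ^ (d.2.1 : ℕ) *
          (y ^ (p * P)) ^ (d.2.2.2 : ℕ))) = ∑ j ∈ range p, aeval x (H j) * y ^ j := by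
    intro x y hx hxy
    have hD := aeval_poleDenom_ne_zero hx
    have e1 : ∀ j, aeval x (H j) * y ^ j = ∑ d, aeval x (C (w d) * q₂ d j) * y ^ j := fun j => by
      rw [map_sum, sum_mul]
    rw [sum_congr rfl fun j _ => e1 j, sum_comm, mul_sum]
    refine sum_congr rfl fun d _ => ?_
    have := hq₂' d x y hD (hcurve hx hxy)
    rw [aeval_poleTraceNumer c hx, map_pow, map_sub, aeval_X, aeval_C, map_zero, add_zero,
      ← pow_eq_add_poleTrace c hxy, ← hPp] at this
    rw [mul_left_comm, this, mul_sum]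
    refine sum_congr rfl fun j _ => ?_
    rw [map_mul, aeval_C, mul_assoc]
  obtain ⟨j₀, hj₀, hHj₀⟩ : ∃ j < p, H j ≠ 0 := by
    by_contra! h
    obtain ⟨x, y, V, hx, hxy, hV, hy, hv⟩ :=
      exists_point_valuation (Ω := Ω) hp hb₀ (hc b₀ hb₀) hΩ
    have h1 := hH hx hxy
    rw [sum_eq_zero (s := range p) fun j hj => by rw [h j (mem_range.1 hj)]; simp] at h1
    exact sum_monomials_ne_zero V hV hy hv w hw
      ((mul_eq_zero.1 h1).resolve_left (pow_ne_zero _ (aeval_poleDenom_ne_zero hx)))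
  have hroot : ∀ v ∈ T, aeval v (H j₀) = 0 := by
    intro v hv
    obtain ⟨hv1, hv2, hv3⟩ := hT v hv
    obtain ⟨y, hy⟩ : ∃ y : Ω, y ^ p - y = poleSum S c v := by
      have hdeg : (X ^ p - X - C (poleSum S c v) : Polynomial Ω).degree ≠ 0 := by
        intro h
        have h0 := natDegree_eq_of_degree_eq_some (n := 0) h
        rw [natDegree_sub_C, FiniteField.X_pow_card_sub_X_natDegree_eq Ω (by omega)] at h0
        omega
      obtain ⟨y, hy⟩ := IsAlgClosed.exists_root _ hdeg
      exact ⟨y, by simpa [IsRoot, sub_eq_zero] using hy⟩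
    -- vanishing at all points above `v`
    have hvan : ∀ z : Ω, z ^ p - z = poleSum S c v →
        ∑ j ∈ range p, aeval v (H j) * z ^ j = 0 := by
      intro z hz
      rw [← hH hv2 hz]
      have hv2' : ∀ b ∈ S, algebraMap (ZMod p) Ω b - v ^ p ^ μ ≠ 0 := by
        intro b hb
        rw [← algebraMap_zmod_pow b μ, ← sub_pow_char_pow]
        exact pow_ne_zero _ (hv2 b hb)
      have hz' : (z ^ p ^ μ) ^ p - z ^ p ^ μ = poleSum S c (v ^ p ^ μ) := by
        rw [← poleSum_pow, ← hz, sub_pow_char_pow, ← pow_mul, ← pow_mul, mul_comm]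
      have hback : z ^ p ^ μ + (poleTrace S c μ (v ^ p ^ μ) - algebraMap (ZMod p) Ω t) = z := by
        rw [← hv3, two_mul, poleTrace_add, pow_eq_add_poleTrace c hz]
        ring
      have hvback : (v ^ p ^ μ) ^ p ^ μ = v := by
        rw [← pow_mul, ← pow_add, ← two_mul, hv1]
      have h1 := hrel hv2' hz'
      rw [hback] at h1
      rw [mul_eq_zero]
      right
      rw [← h1]
      refine sum_congr rfl fun d _ => ?_
      have e1 : (v ^ p ^ μ - algebraMap (ZMod p) Ω b₀) = (v - algebraMap (ZMod p) Ω b₀) ^ p ^ μ := by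
        rw [sub_pow_char_pow, algebraMap_zmod_pow]
      have e2 : (v ^ p ^ μ - algebraMap (ZMod p) Ω b₀) ^ (p ^ μ) = v - algebraMap (ZMod p) Ω b₀ := by
        rw [sub_pow_char_pow, algebraMap_zmod_pow, hvback]
      rw [hPp, pow_add _ (p ^ μ * _), pow_mul _ (p ^ μ), e2, e1, ← pow_mul, pow_add]
      ring
    let G : Polynomial Ω := ∑ j ∈ range p, C (aeval v (H j)) * X ^ j
    have hG : G = 0 := by
      refine eq_zero_of_natDegree_lt_card_of_eval_eq_zero G
        (f := fun a : ZMod p => y + algebraMap (ZMod p) Ω a) ?_ ?_ ?_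
      · exact (add_right_injective y).comp (algebraMap (ZMod p) Ω).injective
      · intro a
        have := hvan (y + algebraMap (ZMod p) Ω a) (by
          rw [add_pow_char, ← hy]
          have := algebraMap_zmod_pow (Ω := Ω) a 1
          rw [pow_one] at this
          rw [this]; ring)
        simpa [G, eval_finsetSum] using this
      · rw [ZMod.card]
        refine lt_of_le_of_lt (natDegree_sum_le_of_forall_le (n := p - 1) _ _ fun j hj => ?_)
          (by omega)
        refine (natDegree_C_mul_X_pow_le _ _).trans ?_
        have := mem_range.1 hj; omega
    have := congrArg (fun g => coeff g j₀) hG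
    simpa [G, finsetSum_coeff, coeff_X_pow, hj₀] using this
  have hcard : #T ≤ (H j₀).natDegree := by
    have h1 : T ⊆ ((H j₀).map (algebraMap (ZMod p) Ω)).roots.toFinset := by
      intro v hv
      rw [Multiset.mem_toFinset, mem_roots (map_ne_zero hHj₀), IsRoot, eval_map_algebraMap]
      exact hroot v hv
    calc #T ≤ _ := card_le_card h1
      _ ≤ _ := Multiset.toFinset_card_le _
      _ ≤ _ := card_roots' _
      _ ≤ _ := natDegree_map_le
  refine hcard.trans ((hHdeg j₀).trans ?_)
  have e1 : p ^ (2 * μ - 1) = p * P * P := by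
    rw [hPp, hP, ← pow_add]; congr 1; omega
  have e2 : M ≤ r * (p * P) := by
    rw [hM]
    apply Nat.mul_le_mul_left
    obtain ⟨p', hp'⟩ : ∃ p', p = p' + 1 := ⟨p - 1, by omega⟩
    rw [hp', Nat.add_sub_cancel, add_mul, one_mul]; omega
  rw [e1, ← hPp]
  have e3 : p * P * (P + r) = p * P * P + r * (p * P) := by ring
  have e4 : (2 * r + 1) * (p * P) = r * (p * P) + r * (p * P) + p * P := by ring
  have e5 : P ≤ p * P := Nat.le_mul_of_pos_left _ (by omega)
  simp only [a₂]
  omega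

end Frobenius

section PowerSums

open Filter Topology

lemma tendsto_one_sub_mul_geom {w : ℂ} :
    Tendsto (fun r : ℝ => (1 - r : ℂ) * ((w * r) / (1 - w * r))) (𝓝[<] 1)
      (𝓝 (if w = 1 then 1 else 0)) := by
  have hr : Tendsto (fun r : ℝ => (r : ℂ)) (𝓝[<] 1) (𝓝 ((1 : ℝ) : ℂ)) :=
    (Complex.continuous_ofReal.tendsto 1).mono_left nhdsWithin_le_nhds
  rw [Complex.ofReal_one] at hr
  split_ifs with h
  · subst h
    refine hr.congr' ?_
    filter_upwards [self_mem_nhdsWithin] with r hr1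
    have : (1 - r : ℂ) ≠ 0 := by
      have : (1 : ℝ) - r ≠ 0 := by have := Set.mem_Iio.1 hr1; linarith
      exact_mod_cast this
    rw [one_mul]
    field_simp
  · have h1 : (1 - w * 1 : ℂ) ≠ 0 := by rw [mul_one, sub_ne_zero]; exact Ne.symm h
    have := ((tendsto_const_nhds (x := (1 : ℂ))).sub hr).mul
      ((hr.const_mul w).div ((tendsto_const_nhds (x := (1 : ℂ))).sub (hr.const_mul w)) h1)
    simpa using this

/-- If the power sums of finitely many complex numbers are bounded, the numbers lie in the closed
unit disc. -/
lemma norm_le_one_of_powerSum_bounded (Z : Multiset ℂ) {B : ℝ}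
    (hB : ∀ n : ℕ, 1 ≤ n → ‖(Z.map (· ^ n)).sum‖ ≤ B) {z : ℂ} (hz : z ∈ Z) : ‖z‖ ≤ 1 := by
  classical
  by_contra! hz1
  obtain ⟨z₁, hz₁, hmax⟩ := Finset.exists_max_image Z.toFinset (fun z => ‖z‖)
    ⟨z, by simpa using hz⟩
  have hz₁1 : 1 < ‖z₁‖ := hz1.trans_le (hmax z (by simpa using hz))
  have hz₁0 : z₁ ≠ 0 := norm_pos_iff.1 (by linarith)
  set ρ : ℝ := ‖z₁‖⁻¹ with hρ
  have hρ0 : 0 ≤ ρ := by positivity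
  have hρ1 : ρ < 1 := inv_lt_one_of_one_lt₀ hz₁1
  have hB0 : 0 ≤ B := (norm_nonneg _).trans (hB 1 le_rfl)
  have key : ∀ r : ℝ, 0 < r → r < 1 →
      ‖(Z.map fun z => (z / z₁ * r) / (1 - z / z₁ * r)).sum‖ ≤ B * (1 - ρ)⁻¹ := by
    intro r hr0 hr1
    have hs : HasSum (fun n : ℕ => (Z.map (· ^ (n + 1))).sum * (r / z₁) ^ (n + 1))
        (Z.map fun z => (z / z₁ * r) / (1 - z / z₁ * r)).sum := by
      have h : ∀ z ∈ Z, HasSum (fun n : ℕ => z ^ (n + 1) * (r / z₁) ^ (n + 1))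
          ((z / z₁ * r) / (1 - z / z₁ * r)) := by
        intro z hz
        have hw : ‖z / z₁ * r‖ < 1 := by
          rw [norm_mul, norm_div, Complex.norm_real, Real.norm_of_nonneg hr0.le]
          have : ‖z‖ / ‖z₁‖ ≤ 1 := div_le_one_of_le₀ (hmax z (by simpa using hz)) (norm_nonneg _)
          nlinarith [div_nonneg (norm_nonneg z) (norm_nonneg z₁)]
        have := (hasSum_geometric_of_norm_lt_one hw).mul_left (z / z₁ * r)
        have hfun : (fun n : ℕ => z ^ (n + 1) * ((r : ℂ) / z₁) ^ (n + 1)) =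
            fun n => z / z₁ * r * (z / z₁ * r) ^ n := by
          funext n
          rw [← mul_pow, ← pow_succ']
          congr 1
          ring
        rw [hfun, div_eq_mul_inv _ (1 - z / z₁ * (r : ℂ))]
        exact this
      clear hB hmax hz₁ hz
      induction Z using Multiset.induction with
      | empty => simp
      | cons a s ih =>
        simp only [Multiset.map_cons, Multiset.sum_cons, add_mul]
        exact (h a (by simp)).add (ih fun z hz => h z (by simp [hz]))
    have hgeo := (hasSum_geometric_of_lt_one hρ0 hρ1).mul_left B
    rw [← hs.tsum_eq, ← hgeo.tsum_eq]
    refine tsum_of_norm_bounded hgeo.summable.hasSum fun n => ?_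
    rw [norm_mul, norm_pow, norm_div, Complex.norm_real, Real.norm_of_nonneg hr0.le]
    refine mul_le_mul (hB _ (by omega)) ?_ (by positivity) hB0
    rw [pow_succ]
    have h1 : r / ‖z₁‖ ≤ ρ := by
      rw [hρ, div_eq_mul_inv]
      exact mul_le_of_le_one_left (by positivity) hr1.le
    calc _ ≤ ρ ^ n * 1 := by
          gcongr
          exact h1.trans hρ1.le
      _ = _ := mul_one _
  have hlim : Tendsto (fun r : ℝ => (1 - r : ℂ) *
      (Z.map fun z => (z / z₁ * r) / (1 - z / z₁ * r)).sum) (𝓝[<] 1)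
      (𝓝 (Z.map fun z => if z / z₁ = 1 then (1 : ℂ) else 0).sum) := by
    simp only [← Multiset.sum_map_mul_left]
    exact tendsto_multiset_sum _ fun z _ => tendsto_one_sub_mul_geom
  have hlim0 : Tendsto (fun r : ℝ => (1 - r : ℂ) *
      (Z.map fun z => (z / z₁ * r) / (1 - z / z₁ * r)).sum) (𝓝[<] 1) (𝓝 0) := by
    have h0 : Tendsto (fun r : ℝ => (1 - r) * (B * (1 - ρ)⁻¹)) (𝓝[<] 1) (𝓝 0) := by
      have : Tendsto (fun r : ℝ => (1 - r) * (B * (1 - ρ)⁻¹)) (𝓝 1)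
          (𝓝 ((1 - 1) * (B * (1 - ρ)⁻¹))) := by
        apply Continuous.tendsto; fun_prop
      rw [sub_self, zero_mul] at this
      exact this.mono_left nhdsWithin_le_nhds
    refine squeeze_zero_norm' ?_ h0
    filter_upwards [Ioo_mem_nhdsLT (zero_lt_one (α := ℝ))] with r hr
    rw [norm_mul]
    have : ‖(1 - r : ℂ)‖ = 1 - r := by
      rw [← Complex.ofReal_one, ← Complex.ofReal_sub, Complex.norm_real,
        Real.norm_of_nonneg (by linarith [hr.2])]
    rw [this]
    exact mul_le_mul_of_nonneg_left (key r hr.1 hr.2) (by linarith [hr.2])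
  have heq := tendsto_nhds_unique hlim hlim0
  have hcount : (Z.map fun z => if z / z₁ = 1 then (1 : ℂ) else 0).sum = (Z.count z₁ : ℂ) := by
    have : (fun z => if z / z₁ = 1 then (1 : ℂ) else 0) = fun z => if z₁ = z then (1 : ℂ) else 0 := by
      funext z
      simp only [div_eq_one_iff_eq hz₁0, eq_comm]
    rw [this]
    clear * -
    induction Z using Multiset.induction with
    | empty => simp
    | cons a s ih =>
      rw [Multiset.map_cons, Multiset.sum_cons, ih, Multiset.count_cons]
      push_cast
      ring
  rw [hcount, Nat.cast_eq_zero, Multiset.count_eq_zero] at heq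
  exact heq (by simpa using hz₁)

/-- A complex polynomial with constant coefficient `1` is a product of factors `1 - ω X`. -/
lemma exists_eq_prod_one_sub {L : Polynomial ℂ} (hL : L.coeff 0 = 1) :
    ∃ W : Multiset ℂ, W.card ≤ L.natDegree ∧ L = (W.map fun ω => 1 - C ω * X).prod := by
  refine ⟨L.roots.map (·⁻¹), by simpa using L.card_roots', ?_⟩
  have hprod : ∀ s : Multiset ℂ, (∀ z ∈ s, z ≠ 0) → (s.map fun a => X - C a).prod =
      C (s.map fun a => -a).prod * ((s.map (·⁻¹)).map fun ω => 1 - C ω * X).prod := by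
    intro s
    induction s using Multiset.induction with
    | empty => simp
    | cons a s ih =>
      intro hs
      have ha : a ≠ 0 := hs a (by simp)
      simp only [Multiset.map_cons, Multiset.prod_cons]
      rw [ih fun z hz => hs z (by simp [hz])]
      have : (X - C a : Polynomial ℂ) = C (-a) * (1 - C a⁻¹ * X) := by
        rw [mul_sub, ← mul_assoc, ← C_mul, neg_mul, mul_inv_cancel₀ ha]; simp; ring
      rw [this, C_mul]; ring
  have h0 : ∀ z ∈ L.roots, z ≠ 0 := by
    rintro z hz rfl
    have := isRoot_of_mem_roots hz
    rw [IsRoot, ← coeff_zero_eq_eval_zero, hL] at this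
    exact one_ne_zero this
  have h1 := (IsAlgClosed.splits L).eq_prod_roots
  rw [hprod _ h0, ← mul_assoc, ← C_mul] at h1
  have h2 := congrArg (eval 0) h1
  rw [← coeff_zero_eq_eval_zero, hL] at h2
  have h3 : eval 0 (((L.roots.map (·⁻¹)).map fun ω => 1 - C ω * X).prod) = 1 := by
    rw [eval_multiset_prod, Multiset.map_map]
    refine Multiset.prod_eq_one fun x hx => ?_
    obtain ⟨a, _, rfl⟩ := Multiset.mem_map.1 hx
    simp
  rw [eval_mul, eval_C, h3, mul_one] at h2
  rw [← h2, C_1, one_mul] at h1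
  exact h1

/-- The Newton identities for `∏ (1 - ω X)`. -/
lemma newton_prod_one_sub (W : Multiset ℂ) (n : ℕ) :
    (n : ℂ) * ((W.map fun ω => 1 - C ω * X).prod : Polynomial ℂ).coeff n =
      -∑ j ∈ Finset.range n, (W.map (· ^ (j + 1))).sum *
        ((W.map fun ω => 1 - C ω * X).prod : Polynomial ℂ).coeff (n - 1 - j) := by
  let f : ℂ → PowerSeries ℂ := fun ω => PowerSeries.mk fun n => ω ^ (n + 1)
  have hf : ∀ ω, (1 - PowerSeries.C ω * PowerSeries.X) * f ω = PowerSeries.C ω := by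
    intro ω
    ext n
    rw [sub_mul, one_mul, mul_assoc, map_sub, PowerSeries.coeff_C_mul, PowerSeries.coeff_C]
    cases n with
    | zero => simp [f]
    | succ n => simp [f, PowerSeries.coeff_succ_X_mul, pow_succ']
  have key : PowerSeries.derivative ℂ
      (((W.map fun ω => 1 - C ω * X).prod : Polynomial ℂ) : PowerSeries ℂ) =
      -((W.map f).sum * (((W.map fun ω => 1 - C ω * X).prod : Polynomial ℂ) : PowerSeries ℂ)) := by
    induction W using Multiset.induction with
    | empty => simp
    | cons a s ih =>
      simp only [Multiset.map_cons, Multiset.prod_cons, Multiset.sum_cons, Polynomial.coe_mul]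
      rw [Derivation.leibniz, ih]
      have h1 : PowerSeries.derivative ℂ ((1 - C a * X : Polynomial ℂ) : PowerSeries ℂ) =
          -PowerSeries.C a := by
        rw [PowerSeries.derivative_coe]
        simp
      have h2 : ((1 - C a * X : Polynomial ℂ) : PowerSeries ℂ) =
          1 - PowerSeries.C a * PowerSeries.X := by simp
      rw [h1, smul_eq_mul, smul_eq_mul, ← hf a, h2]
      ring
  cases n with
  | zero => simp
  | succ n =>
    have := congrArg (PowerSeries.coeff n) key
    rw [PowerSeries.coeff_derivative, map_neg, PowerSeries.coeff_mul,
      Finset.Nat.sum_antidiagonal_eq_sum_range_succ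
        (fun i j => PowerSeries.coeff i (W.map f).sum * PowerSeries.coeff j
          (((W.map fun ω => 1 - C ω * X).prod : Polynomial ℂ) : PowerSeries ℂ))] at this
    simp only [Polynomial.coeff_coe] at this
    rw [mul_comm]
    push_cast
    rw [this]
    congr 1
    refine Finset.sum_congr rfl fun j _ => ?_
    rw [map_multiset_sum, Multiset.map_map]
    simp [f]

end PowerSums

section PoleCharacter

variable {p : ℕ} [Fact p.Prime]

/-- The sum over `S` of the logarithmic derivative of `f`, weighted by `c`. -/
noncomputable def logDerivSum (S : Finset (ZMod p)) (c : ZMod p → ZMod p) (f : (ZMod p)[X]) :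
    ZMod p :=
  ∑ b ∈ S, c b * (f.derivative.eval b / f.eval b)

open Classical in
/-- The multiplicative character of `𝔽_p[X]` attached to the additive character `ψ` and to the
rational function `∑ c b / (b - X)`. -/
noncomputable def poleChar (ψ : AddChar (ZMod p) ℂ) (S : Finset (ZMod p)) (c : ZMod p → ZMod p)
    (f : (ZMod p)[X]) : ℂ :=
  if ∀ b ∈ S, f.eval b ≠ 0 then ψ (logDerivSum S c f) else 0

variable (ψ : AddChar (ZMod p) ℂ) (S : Finset (ZMod p)) (c : ZMod p → ZMod p)

lemma logDerivSum_mul {f g : (ZMod p)[X]} (hf : ∀ b ∈ S, f.eval b ≠ 0)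
    (hg : ∀ b ∈ S, g.eval b ≠ 0) :
    logDerivSum S c (f * g) = logDerivSum S c f + logDerivSum S c g := by
  simp only [logDerivSum, ← sum_add_distrib]
  refine sum_congr rfl fun b hb => ?_
  have := hf b hb
  have := hg b hb
  rw [derivative_mul, eval_add, eval_mul, eval_mul, eval_mul]
  field_simp

lemma poleChar_one : poleChar ψ S c 1 = 1 := by
  simp [poleChar, logDerivSum]

lemma poleChar_mul (f g : (ZMod p)[X]) :
    poleChar ψ S c (f * g) = poleChar ψ S c f * poleChar ψ S c g := by
  by_cases hf : ∀ b ∈ S, f.eval b ≠ 0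
  · by_cases hg : ∀ b ∈ S, g.eval b ≠ 0
    · have hfg : ∀ b ∈ S, (f * g).eval b ≠ 0 := fun b hb => by
        rw [eval_mul]; exact mul_ne_zero (hf b hb) (hg b hb)
      rw [poleChar, poleChar, poleChar, if_pos hf, if_pos hg, if_pos hfg,
        logDerivSum_mul S c hf hg, AddChar.map_add_eq_mul]
    · have hfg : ¬ ∀ b ∈ S, (f * g).eval b ≠ 0 := fun h => hg fun b hb => by
        have := h b hb
        rw [eval_mul] at this
        exact right_ne_zero_of_mul this
      rw [poleChar, poleChar, poleChar, if_neg hg, if_neg hfg, mul_zero]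
  · have hfg : ¬ ∀ b ∈ S, (f * g).eval b ≠ 0 := fun h => hf fun b hb => by
      have := h b hb
      rw [eval_mul] at this
      exact left_ne_zero_of_mul this
    rw [poleChar, poleChar, poleChar, if_neg hf, if_neg hfg, zero_mul]

lemma norm_poleChar_le_one (f : (ZMod p)[X]) : ‖poleChar ψ S c f‖ ≤ 1 := by
  rw [poleChar]
  split_ifs
  · exact (AddChar.norm_apply ψ _).le
  · simp

lemma poleChar_X_sub_C (v : ZMod p) :
    poleChar ψ S c (X - C v) = if v ∈ S then 0 else ψ (∑ b ∈ S, c b / (b - v)) := by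
  rw [poleChar]
  by_cases hv : v ∈ S
  · rw [if_pos hv, if_neg]
    push Not
    exact ⟨v, hv, by simp⟩
  · rw [if_neg hv, if_pos]
    · simp [logDerivSum, div_eq_mul_inv]
    · intro b hb
      rw [eval_sub, eval_X, eval_C, sub_ne_zero]
      rintro rfl
      exact hv hb

variable (p) in
lemma finite_monic_natDegree_eq (m : ℕ) :
    {f : (ZMod p)[X] | f.Monic ∧ f.natDegree = m}.Finite := by
  have : Finite (degreeLT (ZMod p) m) := Finite.of_equiv _ (degreeLTEquiv (ZMod p) m).symm.toEquiv
  refine ((Set.toFinite (degreeLT (ZMod p) m : Set (ZMod p)[X])).image (fun g => X ^ m + g)).subset ?_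
  rintro f ⟨hf, hd⟩
  refine ⟨f - X ^ m, ?_, by simp⟩
  rw [SetLike.mem_coe, mem_degreeLT]
  have h1 : (X ^ m : (ZMod p)[X]).degree = m := degree_X_pow m
  have h2 : f.degree = m := by rw [degree_eq_natDegree hf.ne_zero, hd]
  rw [← h2]
  exact degree_sub_lt_left (h2.trans h1.symm) hf.ne_zero (by simp [hf.leadingCoeff])

variable (p) in
/-- The monic polynomials of degree `m`. -/
noncomputable def monicsOfDegree (m : ℕ) : Finset (ZMod p)[X] :=
  (finite_monic_natDegree_eq p m).toFinset

lemma mem_monicsOfDegree {m : ℕ} {f : (ZMod p)[X]} :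
    f ∈ monicsOfDegree p m ↔ f.Monic ∧ f.natDegree = m := by
  simp [monicsOfDegree]

/-- The coefficients of the `L`-function of `poleChar`. -/
noncomputable def poleCoeff (m : ℕ) : ℂ := ∑ f ∈ monicsOfDegree p m, poleChar ψ S c f

lemma poleCoeff_zero : poleCoeff ψ S c 0 = 1 := by
  have : monicsOfDegree p 0 = {1} := by
    ext f
    rw [mem_monicsOfDegree, mem_singleton]
    constructor
    · rintro ⟨hf, hd⟩
      exact hf.natDegree_eq_zero.1 hd
    · rintro rfl
      exact ⟨monic_one, natDegree_one⟩
  rw [poleCoeff, this, sum_singleton, poleChar_one]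

lemma poleCoeff_one :
    poleCoeff ψ S c 1 = ∑ v ∈ univ \ S, ψ (∑ b ∈ S, c b / (b - v)) := by
  classical
  have : monicsOfDegree p 1 = univ.image fun v : ZMod p => X - C v := by
    ext f
    simp only [mem_monicsOfDegree, mem_image, mem_univ, true_and]
    constructor
    · rintro ⟨hf, hd⟩
      refine ⟨-f.coeff 0, ?_⟩
      rw [C_neg, sub_neg_eq_add]
      exact (hf.eq_X_add_C hd).symm
    · rintro ⟨v, rfl⟩
      exact ⟨monic_X_sub_C v, natDegree_X_sub_C v⟩
  rw [poleCoeff, this, sum_image fun v _ w _ h => by simpa using h]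
  simp only [poleChar_X_sub_C]
  rw [sum_ite, sum_const_zero, zero_add]
  congr 1
  ext v
  simp

lemma exists_eval_derivative_separating {b : ZMod p} (hb : b ∈ S) :
    ∃ E : (ZMod p)[X], E.natDegree < 2 * #S ∧ (∀ b' ∈ S, E.eval b' = 0) ∧
      E.derivative.eval b = 1 ∧ ∀ b' ∈ S, b' ≠ b → E.derivative.eval b' = 0 := by
  classical
  set P : (ZMod p)[X] := ∏ b' ∈ S.erase b, (X - C b') with hP
  have hPb : P.eval b ≠ 0 := by
    rw [hP, eval_prod, prod_ne_zero_iff]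
    intro b' hb'
    rw [eval_sub, eval_X, eval_C, sub_ne_zero]
    exact (ne_of_mem_erase hb').symm
  have hP0 : ∀ b' ∈ S, b' ≠ b → P.eval b' = 0 := fun b' hb' hne => by
    rw [hP, eval_prod]
    exact prod_eq_zero (mem_erase.2 ⟨hne, hb'⟩) (by simp)
  refine ⟨C ((P.eval b ^ 2)⁻¹) * ((X - C b) * P ^ 2), ?_, ?_, ?_, ?_⟩
  · have hPd : P.natDegree = #S - 1 := by
      rw [hP, natDegree_prod_of_monic _ _ fun i _ => monic_X_sub_C i]
      simp [card_erase_of_mem hb]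
    have hS : 0 < #S := card_pos.2 ⟨b, hb⟩
    calc _ ≤ ((X - C b) * P ^ 2).natDegree := natDegree_C_mul_le _ _
      _ ≤ (X - C b).natDegree + (P ^ 2).natDegree := natDegree_mul_le
      _ ≤ 1 + 2 * (#S - 1) := by
        rw [natDegree_X_sub_C, ← hPd]
        gcongr
        exact natDegree_pow_le
      _ < _ := by omega
  · intro b' hb'
    by_cases h : b' = b
    · simp [h]
    · simp [hP0 b' hb' h]
  · simp [derivative_mul, derivative_pow]
    field_simp
  · intro b' hb' h
    simp [derivative_mul, derivative_pow, hP0 b' hb' h]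

lemma poleCoeff_eq_zero (hψ : ψ ≠ 1) (hS : S.Nonempty) (hc : ∀ b ∈ S, c b ≠ 0) {m : ℕ}
    (hm : 2 * #S ≤ m) : poleCoeff ψ S c m = 0 := by
  classical
  obtain ⟨b, hb⟩ := hS
  obtain ⟨a, ha⟩ := AddChar.ne_one_iff.1 hψ
  obtain ⟨E, hE, hE0, hE1, hE2⟩ := exists_eval_derivative_separating S hb
  have hmem : ∀ (s : ZMod p), ∀ f ∈ monicsOfDegree p m,
      f + C (s * f.eval b) * E ∈ monicsOfDegree p m := by
    intro s f hf
    rw [mem_monicsOfDegree] at hf ⊢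
    have hlt : (C (s * f.eval b) * E).degree < f.degree := by
      rw [degree_eq_natDegree hf.1.ne_zero, hf.2]
      refine degree_le_natDegree.trans_lt ?_
      have := natDegree_C_mul_le (s * f.eval b) E
      exact_mod_cast this.trans_lt (hE.trans_le hm)
    exact ⟨hf.1.add_of_left hlt, (natDegree_eq_of_degree_eq
      (degree_add_eq_left_of_degree_lt hlt)).trans hf.2⟩
  have heval : ∀ (s : ZMod p) (f : (ZMod p)[X]), ∀ b' ∈ S,
      (f + C (s * f.eval b) * E).eval b' = f.eval b' := by
    intro s f b' hb'
    simp [hE0 b' hb']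
  have hchar : ∀ f : (ZMod p)[X], poleChar ψ S c (f + C (a / c b * f.eval b) * E) =
      ψ a * poleChar ψ S c f := by
    intro f
    by_cases hf : ∀ b' ∈ S, f.eval b' ≠ 0
    · have hf' : ∀ b' ∈ S, (f + C (a / c b * f.eval b) * E).eval b' ≠ 0 := fun b' hb' => by
        rw [heval _ _ b' hb']; exact hf b' hb'
      rw [poleChar, poleChar, if_pos hf, if_pos hf', ← AddChar.map_add_eq_mul]
      congr 1
      rw [logDerivSum, logDerivSum, ← add_sum_erase _ _ hb, ← add_sum_erase _ _ hb, ← add_assoc]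
      congr 1
      · rw [heval _ _ b hb]
        have := hf b hb
        have := hc b hb
        simp only [derivative_add, derivative_mul, derivative_C, zero_mul, zero_add, eval_add,
          eval_mul, eval_C, hE1]
        field_simp
        ring
      · refine sum_congr rfl fun b' hb' => ?_
        rw [heval _ _ b' (mem_of_mem_erase hb')]
        simp [derivative_mul, hE2 b' (mem_of_mem_erase hb') (ne_of_mem_erase hb')]
    · have hf' : ¬ ∀ b' ∈ S, (f + C (a / c b * f.eval b) * E).eval b' ≠ 0 := fun h => hf
        fun b' hb' => by rw [← heval (a / c b) f b' hb']; exact h b' hb'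
      rw [poleChar, poleChar, if_neg hf, if_neg hf', mul_zero]
  have hsum : poleCoeff ψ S c m = ψ a * poleCoeff ψ S c m := by
    rw [poleCoeff, mul_sum]
    simp only [← hchar]
    refine (sum_nbij' (fun f => f + C (a / c b * f.eval b) * E)
      (fun f => f + C (-(a / c b) * f.eval b) * E) (hmem _) (hmem _) ?_ ?_ ?_).symm
    · intro f _
      simp only [heval _ _ b hb]
      simp
    · intro f _
      simp only [heval _ _ b hb]
      simp
    · intro f _
      rfl
  have : (1 - ψ a) * poleCoeff ψ S c m = 0 := by linear_combination hsum
  exact (mul_eq_zero.1 this).resolve_left (sub_ne_zero.2 (Ne.symm ha))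

end PoleCharacter

section PrimePolynomials

variable {p : ℕ} [Fact p.Prime] {Ω : Type*} [Field Ω] [Algebra (ZMod p) Ω]

lemma isIntegral_of_pow_eq {v : Ω} {j : ℕ} (hj : 1 ≤ j) (hv : v ^ p ^ j = v) :
    IsIntegral (ZMod p) v := by
  have hp : 1 < p ^ j := Nat.one_lt_pow (by omega) (Fact.out : p.Prime).one_lt
  refine ⟨X ^ p ^ j - X, monic_X_pow_sub ?_, by simp [hv]⟩
  rw [degree_X]
  exact_mod_cast hp

lemma pow_eq_iff_natDegree_minpoly_dvd {v : Ω} (hv : IsIntegral (ZMod p) v) (j : ℕ) :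
    v ^ p ^ j = v ↔ (minpoly (ZMod p) v).natDegree ∣ j := by
  have h := (minpoly.irreducible hv).natDegree_dvd_iff_dvd_X_pow_card_pow_sub_X (n := j)
  rw [Nat.card_zmod] at h
  rw [h, minpoly.dvd_iff]
  simp [sub_eq_zero]

lemma eval_frobenius_pow (g : (ZMod p)[X]) (v : Ω) (i : ℕ) :
    aeval (v ^ p ^ i) g = aeval v g ^ p ^ i := by
  have : CharP Ω p := charP_of_injective_algebraMap (algebraMap (ZMod p) Ω).injective p
  have : ExpChar Ω p := ExpChar.prime Fact.out
  have h : (iterateFrobenius Ω p i).comp (algebraMap (ZMod p) Ω) = algebraMap (ZMod p) Ω := by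
    ext x
    rw [RingHom.comp_apply, iterateFrobenius_def, algebraMap_zmod_pow]
  rw [← iterateFrobenius_def, ← iterateFrobenius_def, aeval_def, aeval_def, hom_eval₂, h]

/-- The product of `X - w` over the first `j` Frobenius conjugates `w` of an element fixed by the
`j`-th power of Frobenius is a power of the minimal polynomial. -/
lemma map_minpoly_pow {v : Ω} {j : ℕ} (hj : 1 ≤ j) (hv : v ^ p ^ j = v) :
    (minpoly (ZMod p) v ^ (j / (minpoly (ZMod p) v).natDegree)).map (algebraMap (ZMod p) Ω) =
      ∏ i ∈ range j, (X - C (v ^ p ^ i)) := by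
  have hchar : CharP Ω p := charP_of_injective_algebraMap (algebraMap (ZMod p) Ω).injective p
  have hvint := isIntegral_of_pow_eq hj hv
  set m := minpoly (ZMod p) v with hm
  set d := m.natDegree with hd
  have hd0 : 0 < d := minpoly.natDegree_pos hvint
  have hdvd : d ∣ j := (pow_eq_iff_natDegree_minpoly_dvd hvint j).1 hv
  have hvd : v ^ p ^ d = v := (pow_eq_iff_natDegree_minpoly_dvd hvint d).2 dvd_rfl
  have hbase : m.map (algebraMap (ZMod p) Ω) = ∏ i ∈ range d, (X - C (v ^ p ^ i)) := by
    have hinj : Set.InjOn (fun i => v ^ p ^ i) (range d) := by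
      have key : ∀ i k, i ≤ k → k < d → v ^ p ^ i = v ^ p ^ k → i = k := by
        intro i k hik hk h
        have h1 : (v ^ p ^ (k - i)) ^ p ^ i = v ^ p ^ i := by
          rw [← pow_mul, ← pow_add, Nat.sub_add_cancel hik, h]
        have h2 : v ^ p ^ (k - i) = v := by
          rw [← sub_eq_zero, ← sub_pow_char_pow] at h1
          exact sub_eq_zero.1 (eq_zero_of_pow_eq_zero h1)
        have h3 := (pow_eq_iff_natDegree_minpoly_dvd hvint (k - i)).1 h2
        have := Nat.eq_zero_of_dvd_of_lt h3 ((Nat.sub_le k i).trans_lt hk)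
        omega
      intro i hi k hk h
      have hi := mem_range.1 (mem_coe.1 hi)
      have hk := mem_range.1 (mem_coe.1 hk)
      rcases le_total i k with hik | hik
      · exact key i k hik hk h
      · exact (key k i hik hi h.symm).symm
    have hmon : (m.map (algebraMap (ZMod p) Ω)).Monic := (minpoly.monic hvint).map _
    have hdv : (∏ i ∈ range d, (X - C (v ^ p ^ i)) : Polynomial Ω) ∣
        m.map (algebraMap (ZMod p) Ω) := by
      refine Finset.prod_dvd_of_coprime (fun i hi k hk hik => ?_) fun i _ => ?_
      · exact pairwise_coprime_X_sub_C (s := id) Function.injective_id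
          (fun h => hik (hinj hi hk h))
      · rw [dvd_iff_isRoot, IsRoot, eval_map_algebraMap, eval_frobenius_pow, hm, minpoly.aeval,
          zero_pow (pow_ne_zero _ (Fact.out : p.Prime).ne_zero)]
    refine (eq_of_monic_of_dvd_of_natDegree_le (monic_prod_of_monic _ _ fun i _ => monic_X_sub_C _)
      hmon hdv ?_)
    rw [natDegree_map, natDegree_prod_of_monic _ _ fun i _ => monic_X_sub_C _]
    simp only [natDegree_X_sub_C, sum_const, card_range, smul_eq_mul, mul_one]
    exact hd.ge
  obtain ⟨k, rfl⟩ := hdvd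
  rw [Nat.mul_div_cancel_left _ hd0, Polynomial.map_pow, hbase]
  clear hv hj
  induction k with
  | zero => simp
  | succ k ih =>
    rw [pow_succ, ih, Nat.mul_succ, prod_range_add]
    congr 1
    refine prod_congr rfl fun i _ => ?_
    have : v ^ p ^ (d * k) = v :=
      (pow_eq_iff_natDegree_minpoly_dvd hvint _).2 (dvd_mul_right _ _)
    rw [pow_add, pow_mul, this]

lemma minpoly_pow_dvd_iff {v : Ω} (hvint : IsIntegral (ZMod p) v) (k : ℕ) {f : (ZMod p)[X]}
    (hf : f ≠ 0) : minpoly (ZMod p) v ^ k ∣ f ↔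
      k ≤ (f.map (algebraMap (ZMod p) Ω)).rootMultiplicity v := by
  have hinj := (algebraMap (ZMod p) Ω).injective
  set m := minpoly (ZMod p) v with hm
  have hm0 : m.map (algebraMap (ZMod p) Ω) ≠ 0 :=
    (Polynomial.map_ne_zero_iff hinj).2 (minpoly.ne_zero hvint)
  have hroot : (m.map (algebraMap (ZMod p) Ω)).IsRoot v := by
    rw [IsRoot, eval_map_algebraMap, hm, minpoly.aeval]
  have hmul1 : (m.map (algebraMap (ZMod p) Ω)).rootMultiplicity v = 1 := by
    refine le_antisymm (rootMultiplicity_le_one_of_separable ?_ v)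
      ((rootMultiplicity_pos hm0).2 hroot)
    exact (PerfectField.separable_of_irreducible (minpoly.irreducible hvint)).map
  constructor
  · intro h
    rw [le_rootMultiplicity_iff ((Polynomial.map_ne_zero_iff hinj).2 hf)]
    refine (pow_dvd_pow_of_dvd (dvd_iff_isRoot.2 hroot) k).trans ?_
    rw [← Polynomial.map_pow]
    exact Polynomial.map_dvd _ h
  · induction k generalizing f with
    | zero => intro _; simp
    | succ k ih =>
      intro h
      have hf0 : f.map (algebraMap (ZMod p) Ω) ≠ 0 := (Polynomial.map_ne_zero_iff hinj).2 hf
      have h1 : (f.map (algebraMap (ZMod p) Ω)).IsRoot v :=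
        (rootMultiplicity_pos hf0).1 (by omega)
      have h2 : m ∣ f := by
        rw [hm, minpoly.dvd_iff]
        rwa [IsRoot, eval_map_algebraMap] at h1
      obtain ⟨g, rfl⟩ := h2
      have hg : g ≠ 0 := right_ne_zero_of_mul hf
      rw [Polynomial.map_mul] at hf0 h
      rw [rootMultiplicity_mul hf0, hmul1] at h
      rw [pow_succ']
      exact mul_dvd_mul_left _ (ih hg (by omega))

variable (p Ω) in
/-- The fixed points of the `j`-th power of Frobenius. -/
noncomputable def frobFixed (j : ℕ) : Finset Ω := by
  classical exact (X ^ p ^ j - X : Polynomial Ω).roots.toFinset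

lemma mem_frobFixed {j : ℕ} (hj : 1 ≤ j) {v : Ω} : v ∈ frobFixed p Ω j ↔ v ^ p ^ j = v := by
  have hp : 1 < p ^ j := Nat.one_lt_pow (by omega) (Fact.out : p.Prime).one_lt
  classical
  rw [frobFixed, Multiset.mem_toFinset, mem_roots (FiniteField.X_pow_card_sub_X_ne_zero Ω hp)]
  simp [sub_eq_zero]

lemma card_frobFixed [IsAlgClosed Ω] {j : ℕ} (hj : 1 ≤ j) : #(frobFixed p Ω j) = p ^ j := by
  classical
  have hchar : CharP Ω p := charP_of_injective_algebraMap (algebraMap (ZMod p) Ω).injective p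
  have hp : 1 < p ^ j := Nat.one_lt_pow (by omega) (Fact.out : p.Prime).one_lt
  have hsep : (X ^ p ^ j - X : Polynomial Ω).Separable :=
    galois_poly_separable p _ (dvd_pow_self p (by omega))
  rw [frobFixed, Multiset.toFinset_card_of_nodup (nodup_roots hsep),
    ← (IsAlgClosed.splits _).natDegree_eq_card_roots,
    FiniteField.X_pow_card_sub_X_natDegree_eq Ω hp]

lemma card_sigma_minpoly_pow_dvd [IsAlgClosed Ω] {n : ℕ} {f : (ZMod p)[X]} (hf : f.Monic)
    (hn : f.natDegree = n) :
    open Classical in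
    ∑ j ∈ Icc 1 n, #{v ∈ frobFixed p Ω j |
      minpoly (ZMod p) v ^ (j / (minpoly (ZMod p) v).natDegree) ∣ f} = n := by
  classical
  set F := f.map (algebraMap (ZMod p) Ω) with hF
  have hF0 : F ≠ 0 := (hf.map _).ne_zero
  have hcard : ∑ v ∈ F.roots.toFinset, F.rootMultiplicity v = n := by
    rw [← hn, ← natDegree_map (algebraMap (ZMod p) Ω), (IsAlgClosed.splits _).natDegree_eq_card_roots,
      ← Multiset.toFinset_sum_count_eq]
    simp [hF]
  have hFint : ∀ v, v ∈ F.roots.toFinset → IsIntegral (ZMod p) v := by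
    intro v hv
    rw [Multiset.mem_toFinset, mem_roots hF0, IsRoot, hF, eval_map_algebraMap] at hv
    exact ⟨f, hf, hv⟩
  simp only [← card_sigma]
  have h2 : n = #(F.roots.toFinset.sigma fun v => Icc 1 (F.rootMultiplicity v)) := by
    rw [card_sigma]
    simp [hcard]
  rw [h2]
  refine card_nbij' (fun a => ⟨a.2, a.1 / (minpoly (ZMod p) a.2).natDegree⟩)
    (fun a => ⟨(minpoly (ZMod p) a.1).natDegree * a.2, a.1⟩) ?_ ?_ ?_ ?_
  · rintro ⟨j, v⟩ h
    simp only [coe_sigma, Set.mem_sigma_iff, mem_coe, mem_Icc, mem_filter] at h ⊢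
    obtain ⟨⟨hj, hjn⟩, hv, hdvd⟩ := h
    rw [mem_frobFixed hj] at hv
    have hvint := isIntegral_of_pow_eq hj hv
    have hd := (pow_eq_iff_natDegree_minpoly_dvd hvint j).1 hv
    have hpos : 1 ≤ j / (minpoly (ZMod p) v).natDegree :=
      Nat.div_pos (Nat.le_of_dvd hj hd) (minpoly.natDegree_pos hvint)
    have hle := (minpoly_pow_dvd_iff hvint _ hf.ne_zero).1 hdvd
    refine ⟨?_, hpos, hle⟩
    rw [Multiset.mem_toFinset, mem_roots hF0]
    exact (rootMultiplicity_pos hF0).1 (lt_of_lt_of_le Nat.zero_lt_one (hpos.trans hle))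
  · rintro ⟨v, k⟩ h
    simp only [coe_sigma, Set.mem_sigma_iff, mem_coe, mem_Icc, mem_filter] at h ⊢
    obtain ⟨hv, hk1, hk⟩ := h
    have hvint := hFint v hv
    have hpos := minpoly.natDegree_pos hvint
    have hdvd := (minpoly_pow_dvd_iff hvint _ hf.ne_zero).2 hk
    have hj1 : 1 ≤ (minpoly (ZMod p) v).natDegree * k := Nat.mul_pos hpos hk1
    refine ⟨⟨hj1, ?_⟩, ?_, ?_⟩
    · have := natDegree_le_of_dvd hdvd hf.ne_zero
      rw [natDegree_pow, hn] at this
      rw [mul_comm]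
      exact this.trans h2.le
    · rw [mem_frobFixed hj1]
      exact (pow_eq_iff_natDegree_minpoly_dvd hvint _).2 (dvd_mul_right _ _)
    · rwa [Nat.mul_div_cancel_left _ hpos]
  · rintro ⟨j, v⟩ h
    simp only [coe_sigma, Set.mem_sigma_iff, mem_coe, mem_Icc, mem_filter] at h ⊢
    obtain ⟨⟨hj, hjn⟩, hv, hdvd⟩ := h
    rw [mem_frobFixed hj] at hv
    have hvint := isIntegral_of_pow_eq hj hv
    rw [Nat.mul_div_cancel' ((pow_eq_iff_natDegree_minpoly_dvd hvint j).1 hv)]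
  · rintro ⟨v, k⟩ h
    simp only [coe_sigma, Set.mem_sigma_iff, mem_coe, mem_Icc] at h ⊢
    rw [Nat.mul_div_cancel_left _ (minpoly.natDegree_pos (hFint v h.1))]

end PrimePolynomials

section WeilBound

variable {p : ℕ} [Fact p.Prime] {Ω : Type*} [Field Ω] [Algebra (ZMod p) Ω]
variable (ψ : AddChar (ZMod p) ℂ) (S : Finset (ZMod p)) (c : ZMod p → ZMod p)

variable (Ω) in
/-- The sum of `poleChar` over the points of degree dividing `j`. -/
noncomputable def poleCharSum (j : ℕ) : ℂ :=
  ∑ v ∈ frobFixed p Ω j,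
    poleChar ψ S c (minpoly (ZMod p) v ^ (j / (minpoly (ZMod p) v).natDegree))

lemma natDegree_minpoly_pow {v : Ω} {j : ℕ} (hj : 1 ≤ j) (hv : v ^ p ^ j = v) :
    (minpoly (ZMod p) v ^ (j / (minpoly (ZMod p) v).natDegree)).natDegree = j := by
  rw [natDegree_pow, Nat.div_mul_cancel
    ((pow_eq_iff_natDegree_minpoly_dvd (isIntegral_of_pow_eq hj hv) j).1 hv)]

lemma sum_poleChar_dvd {g : (ZMod p)[X]} (hg : g.Monic) {j n : ℕ} (hgj : g.natDegree = j)
    (hjn : j ≤ n) :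
    open Classical in
    ∑ f ∈ monicsOfDegree p n with g ∣ f, poleChar ψ S c f =
      poleChar ψ S c g * poleCoeff ψ S c (n - j) := by
  classical
  rw [poleCoeff, mul_sum]
  symm
  refine sum_bij (fun h _ => g * h) ?_ ?_ ?_ ?_
  · intro h hh
    rw [mem_monicsOfDegree] at hh
    rw [mem_filter, mem_monicsOfDegree]
    refine ⟨⟨hg.mul hh.1, ?_⟩, dvd_mul_right _ _⟩
    rw [hg.natDegree_mul hh.1, hgj, hh.2]
    omega
  · intro h _ h' _ heq
    exact mul_left_cancel₀ hg.ne_zero heq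
  · intro f hf
    rw [mem_filter, mem_monicsOfDegree] at hf
    obtain ⟨⟨hfm, hfd⟩, h, rfl⟩ := hf
    have hh := hg.of_mul_monic_left hfm
    refine ⟨h, mem_monicsOfDegree.2 ⟨hh, ?_⟩, rfl⟩
    rw [hg.natDegree_mul hh, hgj] at hfd
    omega
  · intro h _
    rw [poleChar_mul]

variable (Ω) in
lemma newton_poleCoeff [IsAlgClosed Ω] (n : ℕ) : (n : ℂ) * poleCoeff ψ S c n =
    ∑ j ∈ range n, poleCharSum Ω ψ S c (j + 1) * poleCoeff ψ S c (n - 1 - j) := by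
  classical
  have h1 : (n : ℂ) * poleCoeff ψ S c n = ∑ f ∈ monicsOfDegree p n,
      ∑ j ∈ Icc 1 n, ∑ v ∈ frobFixed p Ω j,
        if minpoly (ZMod p) v ^ (j / (minpoly (ZMod p) v).natDegree) ∣ f then
          poleChar ψ S c f else 0 := by
    rw [poleCoeff, mul_sum]
    refine sum_congr rfl fun f hf => ?_
    rw [mem_monicsOfDegree] at hf
    have h := card_sigma_minpoly_pow_dvd (Ω := Ω) hf.1 hf.2
    calc (n : ℂ) * poleChar ψ S c f = ((∑ j ∈ Icc 1 n, #{v ∈ frobFixed p Ω j |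
          minpoly (ZMod p) v ^ (j / (minpoly (ZMod p) v).natDegree) ∣ f} : ℕ) : ℂ) *
            poleChar ψ S c f := by
          congr 2
          convert h.symm
      _ = _ := by
          rw [Nat.cast_sum, sum_mul]
          refine sum_congr rfl fun j _ => ?_
          rw [← sum_filter, sum_const, nsmul_eq_mul]
  rw [h1, sum_comm]
  have h2 : ∀ j ∈ Icc 1 n, (∑ f ∈ monicsOfDegree p n, ∑ v ∈ frobFixed p Ω j,
        if minpoly (ZMod p) v ^ (j / (minpoly (ZMod p) v).natDegree) ∣ f then
          poleChar ψ S c f else 0) = poleCharSum Ω ψ S c j * poleCoeff ψ S c (n - j) := by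
    intro j hj
    rw [mem_Icc] at hj
    rw [sum_comm, poleCharSum, sum_mul]
    refine sum_congr rfl fun v hv => ?_
    rw [mem_frobFixed hj.1] at hv
    rw [← sum_filter, ← sum_poleChar_dvd ψ S c ((minpoly.monic (isIntegral_of_pow_eq hj.1 hv)).pow _)
      (natDegree_minpoly_pow hj.1 hv) hj.2]
  rw [sum_congr rfl h2, range_eq_Ico]
  have h3 := sum_Ico_add' (fun j => poleCharSum Ω ψ S c j * poleCoeff ψ S c (n - j)) 0 n 1
  rw [zero_add, Ico_add_one_right_eq_Icc] at h3
  rw [← h3]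
  refine sum_congr rfl fun j _ => ?_
  rw [Nat.sub_sub, add_comm 1 j]

lemma eval_derivative_div_eval_prod {K : Type*} [Field K] (w : ℕ → K) (j : ℕ) {b : K}
    (hb : ∀ i < j, b - w i ≠ 0) :
    (∏ i ∈ range j, (X - C (w i))).derivative.eval b / (∏ i ∈ range j, (X - C (w i))).eval b =
      ∑ i ∈ range j, 1 / (b - w i) := by
  induction j with
  | zero => simp
  | succ j ih =>
    rw [sum_range_succ, ← ih fun i hi => hb i (by omega), prod_range_succ]
    have h1 := hb j (by omega)
    have h2 : (∏ i ∈ range j, (X - C (w i))).eval b ≠ 0 := by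
      rw [eval_prod, prod_ne_zero_iff]
      intro i hi
      simpa using hb i (by have := mem_range.1 hi; omega)
    simp only [derivative_mul, derivative_sub, derivative_X, derivative_C, sub_zero, mul_one,
      eval_add, eval_mul, eval_sub, eval_X, eval_C]
    field_simp

lemma poleChar_minpoly_pow {v : Ω} {j : ℕ} (hj : 1 ≤ j) (hv : v ^ p ^ j = v) :
    ((∃ b ∈ S, algebraMap (ZMod p) Ω b = v) ∧
      poleChar ψ S c (minpoly (ZMod p) v ^ (j / (minpoly (ZMod p) v).natDegree)) = 0) ∨
    (∀ b ∈ S, algebraMap (ZMod p) Ω b - v ≠ 0) ∧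
      ∃ t : ZMod p, poleTrace S c j v = algebraMap (ZMod p) Ω t ∧
        poleChar ψ S c (minpoly (ZMod p) v ^ (j / (minpoly (ZMod p) v).natDegree)) = ψ t := by
  have hchar : CharP Ω p := charP_of_injective_algebraMap (algebraMap (ZMod p) Ω).injective p
  set g := minpoly (ZMod p) v ^ (j / (minpoly (ZMod p) v).natDegree) with hg
  have hmap := map_minpoly_pow hj hv
  rw [← hg] at hmap
  have hsub : ∀ (b : ZMod p) (i : ℕ), algebraMap (ZMod p) Ω b - v ^ p ^ i =
      (algebraMap (ZMod p) Ω b - v) ^ p ^ i := fun b i => by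
    rw [sub_pow_char_pow, algebraMap_zmod_pow]
  have heval : ∀ b : ZMod p, algebraMap (ZMod p) Ω (g.eval b) =
      ∏ i ∈ range j, (algebraMap (ZMod p) Ω b - v) ^ p ^ i := by
    intro b
    rw [← eval_map_apply, hmap, eval_prod]
    refine prod_congr rfl fun i _ => ?_
    rw [eval_sub, eval_X, eval_C, hsub]
  by_cases h : ∀ b ∈ S, algebraMap (ZMod p) Ω b - v ≠ 0
  · right
    have hne : ∀ b ∈ S, g.eval b ≠ 0 := by
      intro b hb h0
      have := heval b
      rw [h0, map_zero, eq_comm, prod_eq_zero_iff] at this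
      obtain ⟨i, _, hi⟩ := this
      exact h b hb (eq_zero_of_pow_eq_zero hi)
    refine ⟨h, logDerivSum S c g, ?_, by rw [poleChar, if_pos hne]⟩
    simp only [poleTrace, poleSum_pow]
    simp only [poleSum, logDerivSum]
    rw [sum_comm, map_sum]
    refine sum_congr rfl fun b hb => ?_
    rw [map_mul, map_div₀, ← eval_map_apply, ← eval_map_apply, ← derivative_map, hmap,
      eval_derivative_div_eval_prod, mul_sum]
    · simp only [mul_one_div]
    · intro i _
      rw [hsub]
      exact pow_ne_zero _ (h b hb)
  · left
    push Not at h
    obtain ⟨b, hb, hbv⟩ := h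
    refine ⟨⟨b, hb, sub_eq_zero.1 hbv⟩, ?_⟩
    rw [poleChar, if_neg]
    push Not
    refine ⟨b, hb, (algebraMap (ZMod p) Ω).injective ?_⟩
    rw [map_zero, heval, hbv, prod_eq_zero (mem_range.2 hj)]
    simp

lemma norm_poleCharSum_le_card [IsAlgClosed Ω] {j : ℕ} (hj : 1 ≤ j) :
    ‖poleCharSum Ω ψ S c j‖ ≤ (p : ℝ) ^ j := by
  refine (norm_sum_le_of_le _ fun v _ => norm_poleChar_le_one ψ S c _).trans ?_
  rw [sum_const, card_frobFixed hj]
  simp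

lemma norm_poleCharSum_le [IsAlgClosed Ω] (hΩ : ∃ x : Ω, Transcendental (ZMod p) x) (hψ : ψ ≠ 1)
    (hS : S.Nonempty) (hc : ∀ b ∈ S, c b ≠ 0) {μ : ℕ} (hμ : 2 ≤ μ) :
    ‖poleCharSum Ω ψ S c (2 * μ)‖ ≤ (2 * #S + 1) * (p : ℝ) ^ (μ + 1) + #S := by
  classical
  set G : Finset Ω := {v ∈ frobFixed p Ω (2 * μ) | ∀ b ∈ S, algebraMap (ZMod p) Ω b - v ≠ 0}
    with hG
  have hj : 1 ≤ 2 * μ := by omega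
  have hGmem : ∀ v ∈ G, v ^ p ^ (2 * μ) = v ∧ (∀ b ∈ S, algebraMap (ZMod p) Ω b - v ≠ 0) := by
    intro v hv
    rw [hG, mem_filter, mem_frobFixed hj] at hv
    exact hv
  have htrace : ∀ v : Ω, ∃ t : ZMod p, v ∈ G → poleTrace S c (2 * μ) v = algebraMap (ZMod p) Ω t ∧
      poleChar ψ S c (minpoly (ZMod p) v ^ (2 * μ / (minpoly (ZMod p) v).natDegree)) = ψ t := by
    intro v
    by_cases hv : v ∈ G
    · obtain ⟨hv1, hv2⟩ := hGmem v hv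
      rcases poleChar_minpoly_pow ψ S c hj hv1 with h | h
      · obtain ⟨⟨b, hb, hbv⟩, _⟩ := h
        exact absurd (sub_eq_zero.2 hbv) (hv2 b hb)
      · exact ⟨h.2.choose, fun _ => h.2.choose_spec⟩
    · exact ⟨0, fun h => absurd h hv⟩
  choose τ hτ using htrace
  have hsum : poleCharSum Ω ψ S c (2 * μ) = ∑ v ∈ G, ψ (τ v) := by
    rw [poleCharSum, ← sum_filter_add_sum_filter_not (frobFixed p Ω (2 * μ))
      (fun v => ∀ b ∈ S, algebraMap (ZMod p) Ω b - v ≠ 0), ← hG]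
    rw [sum_congr rfl fun v hv => (hτ v hv).2, add_eq_left]
    refine sum_eq_zero fun v hv => ?_
    rw [mem_filter, mem_frobFixed hj] at hv
    rcases poleChar_minpoly_pow ψ S c hj hv.1 with h | h
    · exact h.2
    · exact absurd h.1 hv.2
  have hfib : ∀ t : ZMod p, #{v ∈ G | τ v = t} ≤ p ^ (2 * μ - 1) + (2 * #S + 1) * p ^ μ := by
    intro t
    refine card_poleTrace_eq_le c hΩ hS hc hμ t _ fun v hv => ?_
    rw [mem_filter] at hv
    obtain ⟨hv1, hv2⟩ := hGmem v hv.1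
    exact ⟨hv1, hv2, by rw [(hτ v hv.1).1, hv.2]⟩
  set E : ℕ := p ^ (2 * μ - 1) + (2 * #S + 1) * p ^ μ with hE
  have hGcard : p ^ (2 * μ) ≤ #G + #S := by
    rw [← card_frobFixed (Ω := Ω) hj, ← card_filter_add_card_filter_not (s := frobFixed p Ω (2 * μ))
      (fun v => ∀ b ∈ S, algebraMap (ZMod p) Ω b - v ≠ 0), ← hG]
    refine Nat.add_le_add_left ?_ _
    refine (card_le_card (t := S.image (algebraMap (ZMod p) Ω)) fun v hv => ?_).trans card_image_le
    rw [mem_filter] at hv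
    have := hv.2
    push Not at this
    obtain ⟨b, hb, h⟩ := this
    exact mem_image.2 ⟨b, hb, sub_eq_zero.1 h⟩
  have hψ0 : ∑ t : ZMod p, ψ t = 0 := AddChar.sum_eq_zero_of_ne_one hψ
  have hsum2 : ∑ v ∈ G, ψ (τ v) = ∑ t : ZMod p, ((#{v ∈ G | τ v = t} : ℂ) - E) * ψ t := by
    simp only [sub_mul, sum_sub_distrib, ← mul_sum, hψ0, mul_zero, sub_zero]
    rw [← sum_fiberwise G τ]
    refine sum_congr rfl fun t _ => ?_
    rw [sum_congr rfl fun v hv => by rw [(mem_filter.1 hv).2], sum_const, nsmul_eq_mul]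
  rw [hsum, hsum2]
  have hcard : ∑ t : ZMod p, (#{v ∈ G | τ v = t} : ℝ) = #G := by
    rw [← Nat.cast_sum, ← card_eq_sum_card_fiberwise fun v _ => mem_coe.2 (mem_univ _)]
  calc _ ≤ ∑ t : ZMod p, ((E : ℝ) - #{v ∈ G | τ v = t}) := by
        refine norm_sum_le_of_le _ fun t _ => ?_
        have : (#{v ∈ G | τ v = t} : ℝ) ≤ E := by exact_mod_cast hfib t
        rw [norm_mul, AddChar.norm_apply, mul_one, norm_sub_rev]
        rw [← Complex.ofReal_natCast, ← Complex.ofReal_natCast, ← Complex.ofReal_sub,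
          Complex.norm_real, Real.norm_of_nonneg (by linarith)]
    _ = p * E - #G := by
        rw [sum_sub_distrib, hcard]
        simp [ZMod.card]
    _ ≤ p * E - ((p : ℝ) ^ (2 * μ) - #S) := by
        have : (p : ℝ) ^ (2 * μ) ≤ #G + #S := by exact_mod_cast hGcard
        linarith
    _ = _ := by
        rw [hE]
        have : (p : ℝ) ^ (2 * μ) = p * p ^ (2 * μ - 1) := by
          rw [← pow_succ']
          congr 1
          omega
        rw [this]
        push_cast
        ring

/-- The Weil bound for exponential sums attached to a rational function with simple poles. -/
theorem norm_sum_poles_le (hψ : ψ ≠ 1) (hS : S.Nonempty) (hc : ∀ b ∈ S, c b ≠ 0) :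
    ‖∑ v ∈ univ \ S, ψ (∑ b ∈ S, c b / (b - v))‖ ≤ 2 * #S * √p := by
  classical
  let Ω := AlgebraicClosure (RatFunc (ZMod p))
  have hΩ : ∃ x : Ω, Transcendental (ZMod p) x :=
    ⟨algebraMap (RatFunc (ZMod p)) Ω RatFunc.X,
      (transcendental_algebraMap_iff (algebraMap (RatFunc (ZMod p)) Ω).injective).2
        (RatFunc.transcendental_X)⟩
  have hp : 0 < (p : ℝ) := by exact_mod_cast (Fact.out : p.Prime).pos
  set a := poleCoeff ψ S c with ha
  have hr : 0 < #S := card_pos.2 hS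
  set L : ℂ[X] := ∑ m ∈ range (2 * #S), C (a m) * X ^ m with hL
  have hcoeff : ∀ m, L.coeff m = a m := by
    intro m
    rw [hL, finsetSum_coeff]
    simp only [coeff_C_mul_X_pow]
    rw [sum_ite_eq (range (2 * #S)) m]
    split_ifs with h
    · rfl
    · rw [mem_range, not_lt] at h
      exact (poleCoeff_eq_zero ψ S c hψ hS hc h).symm
  have ha0 : a 0 = 1 := poleCoeff_zero ψ S c
  obtain ⟨W, hWcard, hW⟩ := exists_eq_prod_one_sub (L := L) (by rw [hcoeff, ha0])
  have hLdeg : L.natDegree ≤ 2 * #S := by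
    rw [natDegree_le_iff_coeff_eq_zero]
    intro N hN
    rw [hcoeff]
    exact poleCoeff_eq_zero ψ S c hψ hS hc hN.le
  have hnewton : ∀ n : ℕ, (n : ℂ) * a n =
      -∑ j ∈ range n, (W.map (· ^ (j + 1))).sum * a (n - 1 - j) := by
    intro n
    have := newton_prod_one_sub W n
    rw [← hW] at this
    simpa only [hcoeff] using this
  have hpower : ∀ n : ℕ, (W.map (· ^ (n + 1))).sum = -poleCharSum Ω ψ S c (n + 1) := by
    intro n
    induction n using Nat.strong_induction_on with
    | _ n ih =>
      have h1 := hnewton (n + 1)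
      have h2 := newton_poleCoeff Ω ψ S c (n + 1)
      rw [← ha] at h2
      rw [h2, sum_range_succ, sum_range_succ] at h1
      simp only [Nat.add_sub_cancel, Nat.sub_self, ha0, mul_one] at h1
      have h3 : ∑ j ∈ range n, (W.map (· ^ (j + 1))).sum * a (n - j) =
          -∑ j ∈ range n, poleCharSum Ω ψ S c (j + 1) * a (n - j) := by
        rw [← sum_neg_distrib]
        refine sum_congr rfl fun j hj => ?_
        rw [ih j (mem_range.1 hj), neg_mul]
      rw [h3] at h1
      linear_combination h1
  have hW1 : ∀ ω ∈ W, ‖ω‖ ≤ √p := by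
    intro ω hω
    have hB : ∀ n : ℕ, 1 ≤ n → ‖((W.map fun ω => ω ^ 2 / (p : ℂ)).map (· ^ n)).sum‖ ≤
        p + ((2 * #S + 1) * p + #S) := by
      intro n hn
      have h1 : ((W.map fun ω => ω ^ 2 / (p : ℂ)).map (· ^ n)).sum =
          -poleCharSum Ω ψ S c (2 * n) / (p : ℂ) ^ n := by
        have h2 := hpower (2 * n - 1)
        rw [Nat.sub_add_cancel (by omega)] at h2
        rw [← h2, Multiset.map_map, div_eq_mul_inv, ← Multiset.sum_map_mul_right]
        congr 1
        refine Multiset.map_congr rfl fun ω _ => ?_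
        simp only [Function.comp_apply]
        rw [div_pow, ← pow_mul, div_eq_mul_inv]
      rw [h1, norm_div, norm_neg, norm_pow, Complex.norm_natCast, div_le_iff₀ (by positivity)]
      have hp1 : (1 : ℝ) ≤ p ^ n := one_le_pow₀ (by exact_mod_cast (Fact.out : p.Prime).one_le)
      rcases Nat.lt_or_ge n 2 with h | h
      · obtain rfl : n = 1 := by omega
        refine (norm_poleCharSum_le_card ψ S c (by omega)).trans ?_
        rw [pow_one]
        have : 0 ≤ ((2 * #S + 1) * (p : ℝ) + #S) * p := by positivity
        rw [mul_one, pow_two, add_mul]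
        linarith
      · refine (norm_poleCharSum_le ψ S c hΩ hψ hS hc h).trans ?_
        have h3 : (#S : ℝ) ≤ #S * p ^ n := le_mul_of_one_le_right (by positivity) hp1
        have h4 : 0 ≤ (p : ℝ) * p ^ n := by positivity
        rw [pow_succ]
        nlinarith
    have := norm_le_one_of_powerSum_bounded _ hB (Multiset.mem_map_of_mem _ hω)
    rw [norm_div, Complex.norm_natCast, div_le_one hp, norm_pow] at this
    exact Real.le_sqrt_of_sq_le this
  have ha1 : a 1 = -W.sum := by
    have := hnewton 1
    simpa [ha0] using this
  rw [← poleCoeff_one, ← ha, ha1, norm_neg]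
  have hsum : ∀ s : Multiset ℂ, (∀ ω ∈ s, ‖ω‖ ≤ √p) → ‖s.sum‖ ≤ s.card * √p := by
    intro s
    induction s using Multiset.induction with
    | empty => simp
    | cons z s ih =>
      intro hs
      rw [Multiset.sum_cons, Multiset.card_cons]
      push_cast
      have h1 := ih fun ω hω => hs ω (Multiset.mem_cons_of_mem hω)
      have h2 := hs z (Multiset.mem_cons_self _ _)
      have h3 := norm_add_le z s.sum
      linarith
  refine (hsum W hW1).trans ?_
  have : (W.card : ℝ) ≤ 2 * #S := by exact_mod_cast hWcard.trans hLdeg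
  gcongr

end WeilBound

section Moments

variable {p : ℕ} [Fact p.Prime]

lemma psi_eq (x y u : ZMod p) :
    psi p x y u = if u = 0 then 0 else ZMod.stdAddChar (x * u + y * u⁻¹) := by
  rw [psi]
  split_ifs
  · rfl
  · have h := ZMod.stdAddChar_coe (N := p) ((x * u + y * u⁻¹).val : ℤ)
    rw [Int.cast_natCast, ZMod.natCast_zmod_val] at h
    rw [h, Int.cast_natCast]

lemma norm_psi_le_one (x y u : ZMod p) : ‖psi p x y u‖ ≤ 1 := by
  rw [psi_eq]
  split_ifs
  · simp
  · exact (AddChar.norm_apply _ _).le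

/-- The coefficient at the pole `b` of `∑ y / (s i - v) - ∑ y / (t i - v)`. -/
def poleWeight {k : ℕ} (y : ZMod p) (s t : Fin k → ZMod p) (b : ZMod p) : ZMod p :=
  y * ((#{i | s i = b} : ZMod p) - #{i | t i = b})

lemma sum_poleWeight {k : ℕ} (y : ZMod p) (s t : Fin k → ZMod p) (v : ZMod p) :
    ∑ b, poleWeight y s t b / (b - v) =
      ∑ i, y * (s i - v)⁻¹ - ∑ i, y * (t i - v)⁻¹ := by
  have h : ∀ s : Fin k → ZMod p, ∑ b, y * (#{i | s i = b} : ZMod p) / (b - v) =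
      ∑ i, y * (s i - v)⁻¹ := by
    intro s
    rw [← sum_fiberwise univ s]
    refine sum_congr rfl fun b _ => ?_
    rw [sum_congr rfl fun i hi => by rw [(mem_filter.1 hi).2], sum_const, nsmul_eq_mul]
    ring
  rw [← h, ← h, ← sum_sub_distrib]
  refine sum_congr rfl fun b _ => ?_
  rw [poleWeight]
  ring

lemma prod_psi_mul_conj (x y : ZMod p) {k : ℕ} (s t : Fin k → ZMod p) (v : ZMod p) :
    (∏ i, psi p x y (s i - v)) * ∏ i, (starRingEnd ℂ) (psi p x y (t i - v)) =
      if (∀ i, s i ≠ v) ∧ ∀ i, t i ≠ v then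
        ZMod.stdAddChar (x * (∑ i, s i - ∑ i, t i)) *
          ZMod.stdAddChar (∑ b, poleWeight y s t b / (b - v)) else 0 := by
  split_ifs with h
  · have h1 : ∀ i, psi p x y (s i - v) =
        ZMod.stdAddChar (x * (s i - v) + y * (s i - v)⁻¹) := fun i => by
      rw [psi_eq, if_neg (sub_ne_zero.2 (h.1 i))]
    have h2 : ∀ i, (starRingEnd ℂ) (psi p x y (t i - v)) =
        ZMod.stdAddChar (-(x * (t i - v) + y * (t i - v)⁻¹)) := fun i => by
      rw [psi_eq, if_neg (sub_ne_zero.2 (h.2 i)), AddChar.map_neg_eq_conj]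
    have hprod : ∀ g : Fin k → ZMod p, ∏ i, (ZMod.stdAddChar (g i) : ℂ) =
        ZMod.stdAddChar (∑ i, g i) := fun g => by
      induction (univ : Finset (Fin k)) using Finset.induction_on with
      | empty => simp
      | insert a s ha ih => rw [prod_insert ha, sum_insert ha, ih, AddChar.map_add_eq_mul]
    simp only [h1, h2]
    rw [hprod, hprod, ← AddChar.map_add_eq_mul, ← AddChar.map_add_eq_mul, sum_poleWeight]
    congr 1
    simp only [sum_add_distrib, sum_neg_distrib, mul_sub, sum_sub_distrib, mul_sum]
    ring
  · rw [not_and_or] at h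
    push Not at h
    rcases h with ⟨i, hi⟩ | ⟨i, hi⟩
    · rw [prod_eq_zero (mem_univ i), zero_mul]
      simp [psi, hi]
    · rw [prod_eq_zero (i := i) (f := fun i => (starRingEnd ℂ) (psi p x y (t i - v))) (mem_univ i),
        mul_zero]
      simp [psi, hi]

lemma norm_correlation_le (x y : ZMod p) {k : ℕ} (s t : Fin k → ZMod p)
    (h : ∃ b, poleWeight y s t b ≠ 0) :
    ‖∑ v, (∏ i, psi p x y (s i - v)) * ∏ i, (starRingEnd ℂ) (psi p x y (t i - v))‖ ≤
      4 * k * √p + 2 * k := by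
  set T : Finset (ZMod p) := univ.image s ∪ univ.image t with hT
  set S : Finset (ZMod p) := {b | poleWeight y s t b ≠ 0} with hS
  have hTcard : #T ≤ 2 * k := by
    refine (card_union_le _ _).trans ?_
    have h1 := card_image_le (s := (univ : Finset (Fin k))) (f := s)
    have h2 := card_image_le (s := (univ : Finset (Fin k))) (f := t)
    rw [card_univ, Fintype.card_fin] at h1 h2
    omega
  have hST : S ⊆ T := by
    intro b hb
    by_contra hbT
    rw [hT, mem_union, not_or] at hbT
    refine (mem_filter.1 hb).2 ?_
    rw [poleWeight, card_eq_zero.2, card_eq_zero.2]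
    · simp
    · exact filter_eq_empty_iff.2 fun i _ hi => hbT.2 (mem_image.2 ⟨i, mem_univ _, hi⟩)
    · exact filter_eq_empty_iff.2 fun i _ hi => hbT.1 (mem_image.2 ⟨i, mem_univ _, hi⟩)
  have hsum : ∀ v, ∑ b, poleWeight y s t b / (b - v) = ∑ b ∈ S, poleWeight y s t b / (b - v) := by
    intro v
    refine (sum_subset (subset_univ S) fun b _ hb => ?_).symm
    have : poleWeight y s t b = 0 := by
      by_contra hne
      exact hb (mem_filter.2 ⟨mem_univ _, hne⟩)
    rw [this, zero_div]
  have hcond : ∀ v, ((∀ i, s i ≠ v) ∧ ∀ i, t i ≠ v) ↔ v ∈ univ \ T := by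
    intro v
    simp [hT]
  have hψ : (ZMod.stdAddChar : AddChar (ZMod p) ℂ) ≠ 1 := by
    intro h1
    have h2 := ZMod.isPrimitive_stdAddChar p (one_ne_zero)
    rw [h1] at h2
    apply h2
    ext
    simp
  have hweil := norm_sum_poles_le ZMod.stdAddChar S (poleWeight y s t) hψ
    (by obtain ⟨b, hb⟩ := h; exact ⟨b, mem_filter.2 ⟨mem_univ _, hb⟩⟩)
    (fun b hb => (mem_filter.1 hb).2)
  have hsplit : ∑ v ∈ univ \ T, (ZMod.stdAddChar (∑ b ∈ S, poleWeight y s t b / (b - v)) : ℂ) =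
      ∑ v ∈ univ \ S, ZMod.stdAddChar (∑ b ∈ S, poleWeight y s t b / (b - v)) -
        ∑ v ∈ T \ S, ZMod.stdAddChar (∑ b ∈ S, poleWeight y s t b / (b - v)) := by
    have : univ \ T = (univ \ S) \ (T \ S) := by
      ext v
      simp only [mem_sdiff, mem_univ, true_and]
      have := @hST v
      tauto
    rw [this, sum_sdiff_eq_sub (sdiff_subset_sdiff (subset_univ T) le_rfl)]
  simp only [prod_psi_mul_conj, hcond, hsum]
  rw [← sum_filter]
  have : ({v | v ∈ univ \ T} : Finset (ZMod p)) = univ \ T := by ext; simp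
  rw [this, ← mul_sum, norm_mul, AddChar.norm_apply, one_mul, hsplit]
  have hScard : (#S : ℝ) ≤ 2 * k := by exact_mod_cast (card_le_card hST).trans hTcard
  have hTS : ‖∑ v ∈ T \ S, (ZMod.stdAddChar (∑ b ∈ S, poleWeight y s t b / (b - v)) : ℂ)‖ ≤
      2 * k := by
    refine (norm_sum_le_of_le (n := fun _ => 1) _ fun v _ => (AddChar.norm_apply _ _).le).trans ?_
    rw [sum_const, nsmul_one]
    exact_mod_cast (card_le_card sdiff_subset).trans hTcard
  refine (norm_sub_le _ _).trans (add_le_add (hweil.trans ?_) hTS)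
  have := Real.sqrt_nonneg (p : ℝ)
  nlinarith

lemma card_poleWeight_eq_zero_le {y : ZMod p} (hy : y ≠ 0) {k : ℕ} (hk : k < p)
    (B : Finset (ZMod p)) :
    #{st ∈ (Fintype.piFinset fun _ : Fin k => B) ×ˢ (Fintype.piFinset fun _ : Fin k => B) |
      ∀ b, poleWeight y st.1 st.2 b = 0} ≤ k ^ k * #B ^ k := by
  classical
  have hsub : ({st ∈ (Fintype.piFinset fun _ : Fin k => B) ×ˢ (Fintype.piFinset fun _ : Fin k => B) |
      ∀ b, poleWeight y st.1 st.2 b = 0} : Finset _) ⊆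
      ((univ : Finset (Fin k → Fin k)) ×ˢ (Fintype.piFinset fun _ : Fin k => B)).image
        fun a => (a.2 ∘ a.1, a.2) := by
    rintro ⟨s, t⟩ h
    rw [mem_filter, mem_product] at h
    obtain ⟨⟨hs, ht⟩, h⟩ := h
    have key : ∀ i, ∃ i', t i' = s i := by
      intro i
      by_contra! hne
      have := h (s i)
      rw [poleWeight, mul_eq_zero, or_iff_right hy] at this
      rw [card_eq_zero.2 (filter_eq_empty_iff.2 fun i' _ hi' => hne i' hi'), Nat.cast_zero,
        sub_zero, ZMod.natCast_eq_zero_iff] at this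
      have hpos : 0 < #{i' | s i' = s i} := card_pos.2 ⟨i, by simp⟩
      have hle : #{i' | s i' = s i} ≤ k := by
        refine (card_le_univ _).trans ?_
        simp
      have := Nat.le_of_dvd hpos this
      omega
    choose σ hσ using key
    refine mem_image.2 ⟨(σ, t), mem_product.2 ⟨mem_univ _, ht⟩, ?_⟩
    ext1
    · exact funext hσ
    · rfl
  refine (card_le_card hsub).trans (card_image_le.trans ?_)
  rw [card_product, Fintype.card_piFinset_const]
  simp

lemma sum_norm_pow_le (x : ZMod p) {y : ZMod p} (hy : y ≠ 0) {k : ℕ} (hk : k < p)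
    (B : Finset (ZMod p)) :
    ∑ u, ‖∑ b ∈ B, psi p x y (u + b)‖ ^ (2 * k) ≤
      k ^ k * (#B : ℝ) ^ k * p + (#B : ℝ) ^ (2 * k) * (4 * k * √p + 2 * k) := by
  classical
  set Q := Fintype.piFinset fun _ : Fin k => B with hQ
  have hexp : ∀ v : ZMod p, ((‖∑ b ∈ B, psi p x y (b - v)‖ ^ (2 * k) : ℝ) : ℂ) =
      ∑ st ∈ Q ×ˢ Q, (∏ i, psi p x y (st.1 i - v)) *
        ∏ i, (starRingEnd ℂ) (psi p x y (st.2 i - v)) := by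
    intro v
    rw [sum_product]
    simp only [← mul_sum, ← sum_mul]
    rw [← sum_pow' B (fun b => psi p x y (b - v)) k,
      ← sum_pow' B (fun b => (starRingEnd ℂ) (psi p x y (b - v))) k, ← map_sum, ← mul_pow,
      Complex.mul_conj', pow_mul]
    push_cast
    rfl
  have h1 : ((∑ u, ‖∑ b ∈ B, psi p x y (u + b)‖ ^ (2 * k) : ℝ) : ℂ) = ∑ st ∈ Q ×ˢ Q,
      ∑ v, (∏ i, psi p x y (st.1 i - v)) * ∏ i, (starRingEnd ℂ) (psi p x y (st.2 i - v)) := by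
    rw [sum_comm, Complex.ofReal_sum, ← Equiv.sum_comp (Equiv.neg (ZMod p))]
    refine sum_congr rfl fun v _ => ?_
    rw [← hexp]
    simp only [Equiv.neg_apply, neg_add_eq_sub]
  have h2 : ∀ st ∈ Q ×ˢ Q, ‖∑ v, (∏ i, psi p x y (st.1 i - v)) *
      ∏ i, (starRingEnd ℂ) (psi p x y (st.2 i - v))‖ ≤
      (if ∀ b, poleWeight y st.1 st.2 b = 0 then (p : ℝ) else 0) + (4 * k * √p + 2 * k) := by
    intro st _
    split_ifs with h
    · have : ‖∑ v, (∏ i, psi p x y (st.1 i - v)) *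
          ∏ i, (starRingEnd ℂ) (psi p x y (st.2 i - v))‖ ≤ ∑ v : ZMod p, (1 : ℝ) := by
        refine norm_sum_le_of_le _ fun v _ => ?_
        rw [norm_mul, norm_prod, norm_prod]
        refine mul_le_one₀ (prod_le_one (fun _ _ => norm_nonneg _) fun _ _ => norm_psi_le_one _ _ _)
          (prod_nonneg fun _ _ => norm_nonneg _)
          (prod_le_one (fun _ _ => norm_nonneg _) fun _ _ => ?_)
        rw [RCLike.norm_conj]
        exact norm_psi_le_one _ _ _
      rw [sum_const, card_univ, ZMod.card, nsmul_one] at this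
      have h0 : 0 ≤ 4 * k * √p + 2 * (k : ℝ) := by positivity
      linarith
    · push Not at h
      rw [zero_add]
      exact norm_correlation_le x y st.1 st.2 h
  have h3 : ∑ u, ‖∑ b ∈ B, psi p x y (u + b)‖ ^ (2 * k) =
      ‖((∑ u, ‖∑ b ∈ B, psi p x y (u + b)‖ ^ (2 * k) : ℝ) : ℂ)‖ := by
    rw [Complex.norm_real, Real.norm_of_nonneg]
    positivity
  rw [h3, h1]
  refine (norm_sum_le_of_le _ h2).trans ?_
  rw [sum_add_distrib, ← sum_filter, sum_const, sum_const, card_product, hQ,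
    Fintype.card_piFinset_const, nsmul_eq_mul, nsmul_eq_mul]
  have h4 := card_poleWeight_eq_zero_le hy hk B
  have h5 : ((#{st ∈ (Fintype.piFinset fun _ : Fin k => B) ×ˢ (Fintype.piFinset fun _ : Fin k => B) |
      ∀ b, poleWeight y st.1 st.2 b = 0} : ℕ) : ℝ) ≤ k ^ k * (#B : ℝ) ^ k := by exact_mod_cast h4
  refine add_le_add (mul_le_mul_of_nonneg_right h5 (by positivity)) (le_of_eq ?_)
  push_cast
  rw [two_mul k, pow_add]

lemma sum_shifted_psi_pow_le (x : ZMod p) {y : ZMod p} (hy : y ≠ 0) {k : ℕ} (hk1 : 1 ≤ k)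
    (hk : k < p) (B : Finset (ZMod p)) (hB : p ≤ #B ^ (2 * k)) {ι : Type*} (I : Finset ι)
    (u : ι → ZMod p) (hu : Set.InjOn u I) :
    (∑ n ∈ I, ‖∑ b ∈ B, psi p x y (u n + b)‖) ^ (2 * k) ≤
      (#I : ℝ) ^ (2 * k - 1) * ((#B : ℝ) ^ (2 * k) * √p * (k ^ k + 6 * k)) := by
  classical
  have hp : 1 ≤ (p : ℝ) := by exact_mod_cast (Fact.out : p.Prime).one_le
  have h1 : (∑ n ∈ I, ‖∑ b ∈ B, psi p x y (u n + b)‖) ^ (2 * k) ≤ (#I : ℝ) ^ (2 * k - 1) *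
      ∑ n ∈ I, ‖∑ b ∈ B, psi p x y (u n + b)‖ ^ (2 * k) := by
    obtain ⟨n, hn⟩ : ∃ n, 2 * k = n + 1 := ⟨2 * k - 1, by omega⟩
    rw [hn, Nat.add_sub_cancel]
    rcases I.eq_empty_or_nonempty with rfl | hI
    · simp
    have := pow_sum_div_card_le_sum_pow (s := I)
      (f := fun n => ‖∑ b ∈ B, psi p x y (u n + b)‖) (fun _ _ => norm_nonneg _) n
    have hI' : (0 : ℝ) < #I := by exact_mod_cast card_pos.2 hI
    rwa [div_le_iff₀ (by positivity), mul_comm] at this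
  refine h1.trans (mul_le_mul_of_nonneg_left ?_ (by positivity))
  have h2 : ∑ n ∈ I, ‖∑ b ∈ B, psi p x y (u n + b)‖ ^ (2 * k) ≤
      ∑ u, ‖∑ b ∈ B, psi p x y (u + b)‖ ^ (2 * k) := by
    rw [← sum_image (f := fun u => ‖∑ b ∈ B, psi p x y (u + b)‖ ^ (2 * k)) hu]
    exact sum_le_sum_of_subset_of_nonneg (subset_univ _) fun _ _ _ => by positivity
  refine h2.trans ((sum_norm_pow_le x hy hk B).trans ?_)
  have hsq : √p * √p = (p : ℝ) := Real.mul_self_sqrt (by positivity)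
  have hsq1 : 1 ≤ √(p : ℝ) := Real.one_le_sqrt.2 hp
  have hBk : √(p : ℝ) ≤ (#B : ℝ) ^ k := by
    rw [Real.sqrt_le_left (by positivity), ← pow_mul, mul_comm k]
    exact_mod_cast hB
  have h3 : (k : ℝ) ^ k * (#B : ℝ) ^ k * p ≤ k ^ k * ((#B : ℝ) ^ (2 * k) * √p) := by
    calc (k : ℝ) ^ k * (#B : ℝ) ^ k * p = k ^ k * (#B : ℝ) ^ k * (√p * √p) := by rw [hsq]
      _ = k ^ k * ((#B : ℝ) ^ k * √p * √p) := by ring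
      _ ≤ k ^ k * ((#B : ℝ) ^ k * (#B : ℝ) ^ k * √p) := by gcongr
      _ = k ^ k * ((#B : ℝ) ^ (2 * k) * √p) := by rw [two_mul k, pow_add]
  have h4 : 0 ≤ (#B : ℝ) ^ (2 * k) * (2 * k) * (√p - 1) := by
    have : 0 ≤ √(p : ℝ) - 1 := by linarith
    positivity
  linarith

end Moments

section Asymptotics

open Filter Topology

variable {κ : ℝ} {f : ℝ → ℝ}

lemma eventually_rpow_le_deriv_deriv (hpos : ∀ᶠ t in atTop, 0 < deriv (deriv f) t)
    (hlim : Tendsto (fun t => Real.log (deriv (deriv f) t) / Real.log t) atTop (𝓝 (-κ)))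
    {η : ℝ} (hη : 0 < η) :
    ∀ᶠ t in atTop, t ^ (-κ - η) ≤ deriv (deriv f) t ∧ deriv (deriv f) t ≤ t ^ (-κ + η) := by
  have h := hlim.eventually (Ioo_mem_nhds (show -κ - η < -κ by linarith)
    (show -κ < -κ + η by linarith))
  filter_upwards [h, hpos, eventually_gt_atTop 1] with t ht hd h1
  have hlog : 0 < Real.log t := Real.log_pos h1
  rw [lt_div_iff₀ hlog, div_lt_iff₀ hlog] at ht
  have ht0 : 0 < t := by linarith
  constructor
  · rw [← Real.log_le_log_iff (by positivity) hd, Real.log_rpow ht0]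
    exact ht.1.le
  · rw [← Real.log_le_log_iff hd (by positivity), Real.log_rpow ht0]
    exact ht.2.le

lemma hasDerivAt_rpow_div {s t : ℝ} (hs : s ≠ 0) (ht : 0 < t) :
    HasDerivAt (fun t : ℝ => t ^ s / s) (t ^ (s - 1)) t := by
  have := (Real.hasDerivAt_rpow_const (p := s) (Or.inl ht.ne')).div_const s
  rwa [mul_div_cancel_left₀ _ hs] at this

lemma tendsto_deriv_atTop (hκ : κ < 1) (hf' : Differentiable ℝ (deriv f))
    (hpos : ∀ᶠ t in atTop, 0 < deriv (deriv f) t)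
    (hlim : Tendsto (fun t => Real.log (deriv (deriv f) t) / Real.log t) atTop (𝓝 (-κ))) :
    Tendsto (deriv f) atTop atTop := by
  obtain ⟨T, hT⟩ := eventually_atTop.1 ((eventually_rpow_le_deriv_deriv hpos hlim
    (show 0 < (1 - κ) / 2 by linarith)).and (eventually_gt_atTop 0))
  set s := (1 - κ) / 2 with hs
  have hs0 : 0 < s := by rw [hs]; linarith
  have hder : ∀ t ≥ T, HasDerivAt (fun t => deriv f t - t ^ s / s)
      (deriv (deriv f) t - t ^ (s - 1)) t := fun t ht =>
    (hf' t).hasDerivAt.sub (hasDerivAt_rpow_div hs0.ne' (hT t ht).2)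
  have hmono : MonotoneOn (fun t => deriv f t - t ^ s / s) (Set.Ici T) := by
    refine monotoneOn_of_deriv_nonneg (convex_Ici T)
      (fun t ht => (hder t ht).continuousAt.continuousWithinAt)
      (fun t ht => (hder t (interior_subset ht)).differentiableAt.differentiableWithinAt) ?_
    intro t ht
    rw [(hder t (interior_subset ht)).deriv, sub_nonneg]
    have := (hT t (interior_subset ht)).1.1
    rwa [show -κ - s = s - 1 by rw [hs]; ring] at this
  have htop : Tendsto (fun t : ℝ => t ^ s / s + (deriv f T - T ^ s / s)) atTop atTop :=
    tendsto_atTop_add_const_right _ _ ((tendsto_rpow_atTop hs0).atTop_div_const hs0)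
  refine tendsto_atTop_mono' _ ?_ htop
  filter_upwards [eventually_ge_atTop T] with t ht
  have := hmono (Set.mem_Ici.2 le_rfl) (Set.mem_Ici.2 ht) ht
  simp only at this
  linarith

lemma eventually_deriv_le_rpow (hκ : κ < 1) (hf' : Differentiable ℝ (deriv f))
    (hpos : ∀ᶠ t in atTop, 0 < deriv (deriv f) t)
    (hlim : Tendsto (fun t => Real.log (deriv (deriv f) t) / Real.log t) atTop (𝓝 (-κ)))
    {η : ℝ} (hη : 0 < η) : ∀ᶠ t in atTop, deriv f t ≤ t ^ (1 - κ + η) := by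
  obtain ⟨T, hT⟩ := eventually_atTop.1 ((eventually_rpow_le_deriv_deriv hpos hlim
    (half_pos hη)).and (eventually_gt_atTop 0))
  set s := 1 - κ + η / 2 with hs
  have hs0 : 0 < s := by rw [hs]; linarith
  have hder : ∀ t ≥ T, HasDerivAt (fun t => deriv f t - t ^ s / s)
      (deriv (deriv f) t - t ^ (s - 1)) t := fun t ht =>
    (hf' t).hasDerivAt.sub (hasDerivAt_rpow_div hs0.ne' (hT t ht).2)
  have hanti : AntitoneOn (fun t => deriv f t - t ^ s / s) (Set.Ici T) := by
    refine antitoneOn_of_deriv_nonpos (convex_Ici T)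
      (fun t ht => (hder t ht).continuousAt.continuousWithinAt)
      (fun t ht => (hder t (interior_subset ht)).differentiableAt.differentiableWithinAt) ?_
    intro t ht
    rw [(hder t (interior_subset ht)).deriv, sub_nonpos]
    have := (hT t (interior_subset ht)).1.2
    rwa [show -κ + η / 2 = s - 1 by rw [hs]; ring] at this
  have h1 := (tendsto_rpow_atTop (half_pos hη)).eventually_ge_atTop (s⁻¹ + 1)
  have h2 := (tendsto_rpow_atTop hs0).eventually_ge_atTop (deriv f T - T ^ s / s)
  filter_upwards [eventually_ge_atTop T, h1, h2, eventually_gt_atTop 0] with t ht h1 h2 ht0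
  have h3 := hanti (Set.mem_Ici.2 le_rfl) (Set.mem_Ici.2 ht) ht
  simp only at h3
  rw [show 1 - κ + η = s + η / 2 by rw [hs]; ring, Real.rpow_add ht0]
  have h4 := mul_le_mul_of_nonneg_left h1 (Real.rpow_pos_of_pos ht0 s).le
  rw [mul_add, mul_one, ← div_eq_mul_inv] at h4
  linarith

end Asymptotics

section Counting

lemma card_le_of_sub_le (s : Finset ℤ) {D : ℝ} (hD : 0 ≤ D)
    (h : ∀ a ∈ s, ∀ b ∈ s, a ≤ b → (b - a : ℝ) ≤ D) : (#s : ℝ) ≤ D + 1 := by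
  rcases s.eq_empty_or_nonempty with rfl | hs
  · simp; linarith
  · have hsub : s ⊆ Icc (s.min' hs) (s.max' hs) := fun a ha =>
      mem_Icc.2 ⟨min'_le s a ha, le_max' s a ha⟩
    have h1 := card_le_card hsub
    have hle : s.min' hs ≤ s.max' hs := min'_le s _ (max'_mem s hs)
    rw [Int.card_Icc] at h1
    have h2 : (#s : ℤ) ≤ s.max' hs + 1 - s.min' hs := by omega
    have h3 : (#s : ℝ) ≤ s.max' hs + 1 - s.min' hs := by exact_mod_cast h2
    have := h _ (min'_mem s hs) _ (max'_mem s hs) hle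
    linarith

lemma norm_sum_sub_sum_shift_le {E : Type*} [SeminormedAddCommGroup E] (a : ℤ → E)
    (ha : ∀ n, ‖a n‖ ≤ 1) (A B : ℤ) (h : ℕ) :
    ‖∑ n ∈ Ioc A B, a n - ∑ n ∈ Ioc A B, a (n + h)‖ ≤ 2 * h := by
  have h1 : ∑ n ∈ Ioc A B, a (n + h) = ∑ n ∈ Ioc (A + h) (B + h), a n := by
    rw [← map_add_right_Ioc, sum_map]
    rfl
  have hcard : ∀ C : ℤ, ∀ s : Finset ℤ, s ⊆ Ioc C (C + h) → ‖∑ n ∈ s, a n‖ ≤ h := by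
    intro C s hs
    refine (norm_sum_le_of_le (n := fun _ => 1) _ fun n _ => ha n).trans ?_
    rw [sum_const, nsmul_one]
    have := card_le_card hs
    rw [Int.card_Ioc] at this
    have h2 : #s ≤ h := by omega
    exact_mod_cast h2
  rw [h1, ← sum_sdiff_sub_sum_sdiff]
  refine (norm_sub_le _ _).trans ?_
  have h2 := hcard A (Ioc A B \ Ioc (A + h) (B + h)) (by
    intro n hn
    simp only [mem_sdiff, mem_Ioc] at hn ⊢
    omega)
  have h3 := hcard B (Ioc (A + h) (B + h) \ Ioc A B) (by
    intro n hn
    simp only [mem_sdiff, mem_Ioc] at hn ⊢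
    omega)
  linarith

/-- A sequence with steps in `[a, b]` is rarely close to an integer. -/
lemma card_near_int_le (G : ℕ → ℝ) (T : ℕ) {a b δ : ℝ} (ha : 0 < a) (hb : 0 ≤ b) (hδ : 0 ≤ δ)
    (hδ2 : 2 * δ ≤ 1)
    (hG : ∀ t, t + 1 < T → a ≤ G (t + 1) - G t ∧ G (t + 1) - G t ≤ b) :
    open Classical in
    (#{t ∈ range T | ∃ m : ℤ, |G t - m| ≤ δ} : ℝ) ≤ (b * T + 2) * (2 * δ / a + 1) := by
  classical
  have hstep : ∀ t u, t ≤ u → u < T → a * (u - t : ℝ) ≤ G u - G t ∧ G u - G t ≤ b * (u - t : ℝ) := by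
    intro t u htu
    induction u, htu using Nat.le_induction with
    | base => simp
    | succ u htu ih =>
      intro hu
      have h1 := ih (by omega)
      have h2 := hG u hu
      push_cast
      constructor <;> linarith
  set s := {t ∈ range T | ∃ m : ℤ, |G t - m| ≤ δ} with hs
  have hm : ∀ t : ℕ, ∃ m : ℤ, t ∈ s → |G t - m| ≤ δ := by
    intro t
    by_cases h : t ∈ s
    · exact ⟨(mem_filter.1 h).2.choose, fun _ => (mem_filter.1 h).2.choose_spec⟩
    · exact ⟨0, fun h' => absurd h' h⟩
  choose m hm using hm
  have hsT : ∀ t ∈ s, t < T := fun t ht => mem_range.1 (mem_filter.1 ht).1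
  have himage : (#(s.image m) : ℝ) ≤ b * T + 1 + 1 := by
    refine card_le_of_sub_le _ (by positivity) ?_
    intro i hi j hj _
    obtain ⟨t, ht, rfl⟩ := mem_image.1 hi
    obtain ⟨u, hu, rfl⟩ := mem_image.1 hj
    have h1 := abs_le.1 (hm t ht)
    have h2 := abs_le.1 (hm u hu)
    have htT : (t : ℝ) ≤ T := by exact_mod_cast (hsT t ht).le
    have huT : (u : ℝ) ≤ T := by exact_mod_cast (hsT u hu).le
    have h3 : G u - G t ≤ b * T := by
      rcases le_total t u with h | h
      · have := (hstep t u h (hsT u hu)).2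
        have ht0 : (0 : ℝ) ≤ t := by positivity
        nlinarith
      · have := (hstep u t h (hsT t ht)).1
        have htu : (u : ℝ) ≤ t := by exact_mod_cast h
        have : 0 ≤ b * T := by positivity
        nlinarith
    linarith
  have hfiber : ∀ i ∈ s.image m, (#{t ∈ s | m t = i} : ℝ) ≤ 2 * δ / a + 1 := by
    intro i _
    rw [← card_map (Nat.castEmbedding : ℕ ↪ ℤ)]
    refine card_le_of_sub_le _ (by positivity) ?_
    intro t' ht' u' hu' htu
    obtain ⟨t, ht, rfl⟩ := mem_map.1 ht'
    obtain ⟨u, hu, rfl⟩ := mem_map.1 hu'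
    rw [mem_filter] at ht hu
    have h1 := abs_le.1 (hm t ht.1)
    have h2 := abs_le.1 (hm u hu.1)
    rw [ht.2] at h1
    rw [hu.2] at h2
    have htu' : t ≤ u := by simpa using htu
    have := (hstep t u htu' (hsT u hu.1)).1
    rw [le_div_iff₀ ha]
    simp only [Nat.castEmbedding_apply, Int.cast_natCast]
    linarith
  have hsum : (#s : ℝ) = ∑ i ∈ s.image m, (#{t ∈ s | m t = i} : ℝ) := by
    rw [← Nat.cast_sum, ← card_eq_sum_card_image]
  rw [hsum]
  refine (sum_le_card_nsmul _ _ _ hfiber).trans ?_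
  rw [nsmul_eq_mul]
  refine mul_le_mul_of_nonneg_right (by linarith) (by positivity)

end Counting

section NearIntegers

variable {f : ℝ → ℝ}

lemma exists_deriv_mul_eq_sub (hf : Differentiable ℝ f) {a b : ℝ} (hab : a ≤ b) :
    ∃ c ∈ Set.Icc a b, f b - f a = deriv f c * (b - a) := by
  rcases hab.eq_or_lt with rfl | hab
  · exact ⟨a, by simp, by simp⟩
  · obtain ⟨c, hc, h⟩ := exists_deriv_eq_slope f hab hf.continuous.continuousOn
      hf.differentiableOn
    refine ⟨c, Set.Ioo_subset_Icc_self hc, ?_⟩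
    rw [h, div_mul_cancel₀ _ (by linarith)]

open Classical in
/-- If `h * deriv f` stays at distance comparable to `s` from an integer, then `f` is rarely close to
an integer along the progression `x + h * t`. -/
lemma card_near_int_progression_le (hf : Differentiable ℝ f) {x δ : ℝ} {h T : ℕ} {m : ℤ}
    (hvar : ∀ ξ ∈ Set.Icc x (x + h * T),
      |h * deriv f ξ - h * deriv f x| ≤ |h * deriv f x - m| / 2)
    (hδ : |h * deriv f x - m| ≤ δ) (hδ2 : 2 * δ ≤ 1) (hT : 2 ≤ |h * deriv f x - m| * T) :
    (#{t ∈ range T | ∃ k : ℤ, |f (x + h * (t : ℕ)) - k| ≤ δ} : ℝ) ≤ 12 * δ * T + 2 := by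
  set s := |h * deriv f x - m| with hs
  have hT0 : (0 : ℝ) ≤ T := by positivity
  have hs0 : 0 < s := by
    rcases (abs_nonneg (h * deriv f x - m)).eq_or_lt with h0 | h0
    · rw [hs, ← h0] at hT; norm_num at hT
    · exact h0
  have hstep : ∀ t : ℕ, t + 1 < T → ∃ ξ ∈ Set.Icc x (x + h * T),
      f (x + h * (t + 1 : ℕ)) - m * (t + 1 : ℕ) - (f (x + h * t) - m * t) =
        h * deriv f ξ - m := by
    intro t ht
    have hh : (0 : ℝ) ≤ h := by positivity
    have htT : (t + 1 : ℝ) ≤ T := by exact_mod_cast ht.le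
    obtain ⟨ξ, hξ, he⟩ := exists_deriv_mul_eq_sub hf
      (show x + h * (t : ℝ) ≤ x + h * ((t + 1 : ℕ) : ℝ) by push_cast; nlinarith)
    refine ⟨ξ, ⟨?_, ?_⟩, ?_⟩
    · have : (0 : ℝ) ≤ h * t := by positivity
      linarith [hξ.1]
    · refine hξ.2.trans ?_
      push_cast
      nlinarith
    · push_cast at he ⊢
      linarith
  have key : ∃ G : ℕ → ℝ, (∀ t, t + 1 < T → s / 2 ≤ G (t + 1) - G t ∧
      G (t + 1) - G t ≤ 3 * s / 2) ∧
      ∀ t : ℕ, (∃ k : ℤ, |f (x + h * t) - k| ≤ δ) → ∃ k : ℤ, |G t - k| ≤ δ := by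
    rcases le_total 0 (h * deriv f x - m) with h0 | h0
    · refine ⟨fun t => f (x + h * t) - m * t, ?_, ?_⟩
      · intro t ht
        obtain ⟨ξ, hξ, he⟩ := hstep t ht
        have h1 := abs_le.1 (hvar ξ hξ)
        rw [hs, abs_of_nonneg h0] at *
        simp only [he]
        constructor <;> linarith
      · rintro t ⟨k, hk⟩
        refine ⟨k - m * t, ?_⟩
        push_cast
        rwa [sub_sub_sub_cancel_right]
    · refine ⟨fun t => -(f (x + h * t) - m * t), ?_, ?_⟩
      · intro t ht
        obtain ⟨ξ, hξ, he⟩ := hstep t ht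
        have h1 := abs_le.1 (hvar ξ hξ)
        rw [hs, abs_of_nonpos h0] at *
        have he' : -(f (x + h * (t + 1 : ℕ)) - m * (t + 1 : ℕ)) - -(f (x + h * t) - m * t) =
          -(h * deriv f ξ - m) := by linarith
        simp only [he']
        constructor <;> linarith
      · rintro t ⟨k, hk⟩
        refine ⟨-(k - m * t), ?_⟩
        push_cast
        rwa [← neg_sub', abs_neg, sub_sub_sub_cancel_right]
  obtain ⟨G, hG, hGf⟩ := key
  have hδ0 : 0 ≤ δ := hs0.le.trans hδ
  refine (Nat.cast_le.2 (card_le_card (monotone_filter_right _ fun t _ => hGf t))).trans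
    ((card_near_int_le G T (half_pos hs0) (by positivity) hδ0 hδ2 hG).trans ?_)
  have h1 : δ / s ≤ δ * T / 2 := by
    rw [div_le_iff₀ hs0]
    nlinarith
  have h2 : (3 * s / 2 * T + 2) * (2 * δ / (s / 2) + 1) =
      6 * δ * T + 3 / 2 * (s * T) + 8 * (δ / s) + 2 := by
    field_simp
    ring
  rw [h2]
  have h3 : s * T ≤ δ * T := mul_le_mul_of_nonneg_right hδ hT0
  have h4 : 0 ≤ δ * T := by positivity
  linarith

open Classical in
/-- Values of a function with positive second derivative are rarely close to integers. -/
lemma card_near_int_values_le (hf : Differentiable ℝ f) (hf' : Differentiable ℝ (deriv f))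
    {K L lam Lam δ : ℝ} {h T : ℕ} {m : ℤ} (hL : 0 ≤ L) (hh : 1 ≤ h) (hlam : 0 < lam)
    (hf2 : ∀ t ∈ Set.Icc K (K + 2 * L),
      lam ≤ deriv (deriv f) t ∧ deriv (deriv f) t ≤ Lam)
    (hm : ∀ t ∈ Set.Icc K (K + 2 * L), |h * deriv f t - m| ≤ δ) (hδ2 : 2 * δ ≤ 1)
    (hTL : (h : ℝ) * T ≤ L) (hT : 1 ≤ (h : ℝ) ^ 2 * T ^ 2 * Lam) :
    (#{n ∈ Ioc ⌊K⌋ ⌊K + L⌋ | ∃ k : ℤ, |f (n : ℤ) - k| ≤ δ} : ℝ) ≤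
      4 * h * T * Lam / lam + 1 + #(Ioc ⌊K⌋ ⌊K + L⌋) * (12 * δ + 2 / T) + 2 * h * T := by
  set I := Ioc ⌊K⌋ ⌊K + L⌋ with hI
  have hIK : ∀ n ∈ I, K ≤ (n : ℝ) ∧ (n : ℝ) ≤ K + L := by
    intro n hn
    rw [hI, mem_Ioc, Int.floor_lt, Int.le_floor] at hn
    exact ⟨hn.1.le, hn.2⟩
  have hT0 : 0 < (T : ℝ) := by
    rcases Nat.eq_zero_or_pos T with rfl | h0
    · norm_num at hT
    · exact_mod_cast h0
  have hh0 : (1 : ℝ) ≤ h := by exact_mod_cast hh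
  have hδ0 : 0 ≤ δ := (abs_nonneg _).trans (hm K ⟨le_rfl, by linarith⟩)
  have hLam : lam ≤ Lam := (hf2 K ⟨le_rfl, by linarith⟩).1.trans (hf2 K ⟨le_rfl, by linarith⟩).2
  set ω : ℝ := h ^ 2 * T * Lam with hω
  have hω0 : 0 < ω := by
    have : 0 < Lam := hlam.trans_le hLam
    positivity
  have hωT : 1 ≤ ω * T := by
    rw [hω]; linarith
  have hmvt : ∀ a ∈ Set.Icc K (K + 2 * L), ∀ b ∈ Set.Icc K (K + 2 * L), a ≤ b →
      lam * (b - a) ≤ deriv f b - deriv f a ∧ deriv f b - deriv f a ≤ Lam * (b - a) := by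
    intro a ha b hb hab
    obtain ⟨c, hc, he⟩ := exists_deriv_mul_eq_sub hf' hab
    have := hf2 c ⟨ha.1.trans hc.1, hc.2.trans hb.2⟩
    rw [he]
    exact ⟨mul_le_mul_of_nonneg_right this.1 (by linarith),
      mul_le_mul_of_nonneg_right this.2 (by linarith)⟩
  let P : ℤ → Prop := fun n => ∃ k : ℤ, |f n - k| ≤ δ
  let a : ℤ → ℝ := fun n => if P n then 1 else 0
  have ha : ∀ n, ‖a n‖ ≤ 1 := by
    intro n
    simp only [a]
    split_ifs <;> simp
  have hcard : (#{n ∈ I | P n} : ℝ) = ∑ n ∈ I, a n := by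
    simp [a]
  have hshift : ∀ t ∈ range T, ∑ n ∈ I, a n ≤ ∑ n ∈ I, a (n + (h * t : ℕ)) + 2 * h * T := by
    intro t ht
    have h1 := (le_abs_self _).trans (norm_sum_sub_sum_shift_le a ha ⌊K⌋ ⌊K + L⌋ (h * t))
    have h2 : (t : ℝ) ≤ T := by exact_mod_cast (mem_range.1 ht).le
    push_cast at h1 ⊢
    have h3 : (h : ℝ) * t ≤ h * T := by gcongr
    linarith
  have havg := sum_le_sum hshift
  rw [sum_const, card_range, nsmul_eq_mul, sum_add_distrib, sum_const, card_range, nsmul_eq_mul,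
    sum_comm] at havg
  have hinner : ∀ n : ℤ, ∑ t ∈ range T, a (n + (h * t : ℕ)) =
      (#{t ∈ range T | ∃ k : ℤ, |f ((n : ℝ) + h * (t : ℕ)) - k| ≤ δ} : ℝ) := by
    intro n
    simp [a, P]
  set J := {n ∈ I | |h * deriv f (n : ℤ) - m| < 2 * ω} with hJ
  have hJcard : (#J : ℝ) ≤ 4 * ω / (h * lam) + 1 := by
    refine card_le_of_sub_le _ (by positivity) ?_
    intro b hb c hc hbc
    rw [hJ, mem_filter] at hb hc
    have h1 := abs_lt.1 hb.2
    have h2 := abs_lt.1 hc.2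
    have hbI := hIK b hb.1
    have hcI := hIK c hc.1
    have h3 := (hmvt b ⟨hbI.1, by linarith⟩ c ⟨hcI.1, by linarith⟩ (by exact_mod_cast hbc)).1
    rw [le_div_iff₀ (by positivity)]
    nlinarith
  have hbound : ∀ n ∈ I, ∑ t ∈ range T, a (n + (h * t : ℕ)) ≤
      (if n ∈ J then (T : ℝ) else 0) + (12 * δ * T + 2) := by
    intro n hn
    rw [hinner]
    have hnI := hIK n hn
    split_ifs with hnJ
    · have h1 := card_filter_le (range T) fun t : ℕ =>
        ∃ k : ℤ, |f ((n : ℝ) + h * (t : ℕ)) - k| ≤ δ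
      rw [card_range] at h1
      have h2 : 0 ≤ δ * T := by positivity
      have h3 := (Nat.cast_le (α := ℝ)).2 h1
      linarith
    · rw [zero_add]
      have hn2 : 2 * ω ≤ |(h : ℝ) * deriv f n - m| := by
        by_contra! h'
        exact hnJ (mem_filter.2 ⟨hn, h'⟩)
      refine card_near_int_progression_le hf ?_ (hm n ⟨hnI.1, by linarith⟩) hδ2 (by nlinarith)
      intro ξ hξ
      have h1 := hmvt n ⟨hnI.1, by linarith⟩ ξ ⟨hnI.1.trans hξ.1, by linarith [hξ.2]⟩ hξ.1
      have h2 : 0 ≤ ξ - n := by linarith [hξ.1]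
      have h3 : ξ - n ≤ h * T := by linarith [hξ.2]
      rw [← mul_sub, abs_of_nonneg (mul_nonneg (by positivity) (le_trans (by positivity) h1.1))]
      calc (h : ℝ) * (deriv f ξ - deriv f n) ≤ h * (Lam * (h * T)) := by
            refine mul_le_mul_of_nonneg_left (h1.2.trans ?_) (by positivity)
            exact mul_le_mul_of_nonneg_left h3 (hlam.le.trans hLam)
        _ = ω := by rw [hω]; ring
        _ ≤ _ := by linarith
  have h1 := havg.trans (add_le_add_left (sum_le_sum hbound) _)
  have hJI : {n ∈ I | n ∈ J} = J := by
    ext n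
    simp only [mem_filter, hJ]
    tauto
  have hJsum : ∑ n ∈ I, (if n ∈ J then (T : ℝ) else 0) = #J * T := by
    rw [← sum_filter, hJI, sum_const, nsmul_eq_mul]
  rw [sum_add_distrib, hJsum, sum_const, nsmul_eq_mul] at h1
  change (#{n ∈ I | P n} : ℝ) ≤ _
  rw [hcard, ← mul_le_mul_iff_of_pos_left hT0]
  refine h1.trans ?_
  have h2 : (#J : ℝ) * T ≤ (4 * ω / (h * lam) + 1) * T :=
    mul_le_mul_of_nonneg_right hJcard hT0.le
  have h3 : 4 * ω / (h * lam) = 4 * h * T * Lam / lam := by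
    rw [hω]; field_simp
  rw [h3] at h2
  have h4 : (T : ℝ) * (#I * (12 * δ + 2 / T)) = #I * (12 * δ * T + 2) := by
    field_simp
  linarith

end NearIntegers

section Shift

variable {f : ℝ → ℝ}

lemma floor_eq_add_of_forall_lt {a b δ : ℝ} {m : ℤ} (ha : ∀ k : ℤ, δ < |a - k|)
    (hab : |b - a - m| ≤ δ) : ⌊b⌋ = ⌊a⌋ + m := by
  have h1 := abs_le.1 hab
  have h2 := ha ⌊a⌋
  have h3 := ha (⌊a⌋ + 1)
  rw [abs_of_nonneg (by linarith [Int.floor_le a])] at h2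
  rw [abs_of_nonpos (by push_cast; linarith [Int.lt_floor_add_one a])] at h3
  rw [Int.floor_eq_iff]
  push_cast at h3 ⊢
  constructor <;> linarith

open Classical in
lemma card_mul_norm_sum_psi_le {p : ℕ} [Fact p.Prime] (x y : ZMod p) (hf : Differentiable ℝ f)
    {K L τ δ : ℝ} {h J : ℕ} {m : ℤ}
    (hm : ∀ t ∈ Set.Icc K (K + 2 * L), |h * deriv f t - m| ≤ τ)
    (hτ : J * τ ≤ δ) (hJL : (h : ℝ) * J ≤ L) (hJp : J ≤ p) (hmp : (m : ZMod p) ≠ 0) :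
    ∃ B : Finset (ZMod p), #B = J ∧
      J * ‖∑ n ∈ Ioc ⌊K⌋ ⌊K + L⌋, psi p x y ((⌊f n⌋ : ℤ) : ZMod p)‖ ≤
        ∑ n ∈ Ioc ⌊K⌋ ⌊K + L⌋, ‖∑ b ∈ B, psi p x y (((⌊f n⌋ : ℤ) : ZMod p) + b)‖ +
        J * (2 * h * J + 2 * #{n ∈ Ioc ⌊K⌋ ⌊K + L⌋ | ∃ k : ℤ, |f (n : ℤ) - k| ≤ δ}) := by
  set I := Ioc ⌊K⌋ ⌊K + L⌋ with hI
  have hIK : ∀ n ∈ I, K ≤ (n : ℝ) ∧ (n : ℝ) ≤ K + L := by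
    intro n hn
    rw [hI, mem_Ioc, Int.floor_lt, Int.le_floor] at hn
    exact ⟨hn.1.le, hn.2⟩
  have hinj : Set.InjOn (fun j : ℕ => (j : ZMod p) * m) (range J) := by
    intro i hi j hj hij
    rw [mem_coe, mem_range] at hi hj
    have h1 := mul_right_cancel₀ hmp hij
    rw [ZMod.natCast_eq_natCast_iff', Nat.mod_eq_of_lt (by omega),
      Nat.mod_eq_of_lt (by omega)] at h1
    exact h1
  refine ⟨(range J).image fun j : ℕ => (j : ZMod p) * m, by rw [card_image_of_injOn hinj, card_range],
    ?_⟩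
  set a : ℤ → ℂ := fun n => psi p x y ((⌊f n⌋ : ℤ) : ZMod p) with ha
  set P : ℤ → Prop := fun n => ∃ k : ℤ, |f n - k| ≤ δ with hP
  have hshift : ∀ j ∈ range J, ‖∑ n ∈ I, a n - ∑ n ∈ I,
      psi p x y (((⌊f n⌋ : ℤ) : ZMod p) + j * m)‖ ≤ 2 * h * J + 2 * #{n ∈ I | P n} := by
    intro j hj
    have hjJ : (j : ℝ) ≤ J := by exact_mod_cast (mem_range.1 hj).le
    have h1 := norm_sum_sub_sum_shift_le a (fun n => norm_psi_le_one _ _ _) ⌊K⌋ ⌊K + L⌋ (h * j)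
    have h2 : ‖∑ n ∈ I, a (n + (h * j : ℕ)) - ∑ n ∈ I,
        psi p x y (((⌊f n⌋ : ℤ) : ZMod p) + j * m)‖ ≤ 2 * #{n ∈ I | P n} := by
      rw [← sum_sub_distrib]
      have h3 : ∀ n ∈ I, ‖a (n + (h * j : ℕ)) - psi p x y (((⌊f n⌋ : ℤ) : ZMod p) + j * m)‖ ≤
          if P n then 2 else 0 := by
        intro n hn
        split_ifs with hPn
        · refine (norm_sub_le _ _).trans ?_
          have h4 := norm_psi_le_one x y ((⌊f ((n + (h * j : ℕ) : ℤ) : ℝ)⌋ : ℤ) : ZMod p)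
          have h5 := norm_psi_le_one x y (((⌊f n⌋ : ℤ) : ZMod p) + j * m)
          simp only [ha]
          linarith
        · have hnI := hIK n hn
          have hj0 : (0 : ℝ) ≤ h * j := by positivity
          have hhj : (h : ℝ) * j ≤ h * J := by gcongr
          obtain ⟨ξ, hξ, he⟩ := exists_deriv_mul_eq_sub hf
            (show (n : ℝ) ≤ ((n + (h * j : ℕ) : ℤ) : ℝ) by push_cast; linarith)
          have hξ' := hξ.2
          push_cast at hξ' he
          have h4 := hm ξ ⟨hnI.1.trans hξ.1, by linarith⟩
          have hfloor : ⌊f ((n + (h * j : ℕ) : ℤ) : ℝ)⌋ = ⌊f n⌋ + j * m := by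
            have hfl := floor_eq_add_of_forall_lt (a := f n) (δ := δ) (m := j * m)
              (b := f ((n + (h * j : ℕ) : ℤ) : ℝ)) (fun k => ?_) ?_
            · exact_mod_cast hfl
            · by_contra! hk
              exact hPn ⟨k, hk⟩
            · push_cast
              rw [he, show deriv f ξ * (n + h * j - n) - j * m = j * (h * deriv f ξ - m) by ring,
                abs_mul, Nat.abs_cast]
              refine le_trans ?_ hτ
              exact mul_le_mul hjJ h4 (abs_nonneg _) (by positivity)
          simp only [ha, hfloor]
          push_cast
          simp
      refine (norm_sum_le_of_le _ h3).trans ?_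
      rw [← sum_filter, sum_const, nsmul_eq_mul, mul_comm]
    have h3 := norm_sub_le_norm_sub_add_norm_sub (∑ n ∈ I, a n) (∑ n ∈ I, a (n + (h * j : ℕ)))
      (∑ n ∈ I, psi p x y (((⌊f n⌋ : ℤ) : ZMod p) + j * m))
    have h4 : (h : ℝ) * j ≤ h * J := by gcongr
    push_cast at h1
    push_cast at h2 h3
    linarith
  have h1 := norm_sum_le_of_le _ hshift
  rw [sum_sub_distrib, sum_const, sum_const, card_range, nsmul_eq_mul, nsmul_eq_mul] at h1
  have h2 := norm_sub_norm_le ((J : ℂ) * ∑ n ∈ I, a n)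
    (∑ j ∈ range J, ∑ n ∈ I, psi p x y (((⌊f n⌋ : ℤ) : ZMod p) + j * m))
  rw [norm_mul, Complex.norm_natCast] at h2
  have h3 : ‖∑ j ∈ range J, ∑ n ∈ I, psi p x y (((⌊f n⌋ : ℤ) : ZMod p) + j * m)‖ ≤
      ∑ n ∈ I, ‖∑ b ∈ (range J).image fun j : ℕ => (j : ZMod p) * m,
        psi p x y (((⌊f n⌋ : ℤ) : ZMod p) + b)‖ := by
    rw [sum_comm]
    refine norm_sum_le_of_le _ fun n _ => ?_
    rw [sum_image hinj]
  linarith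

end Shift

section MainBound

variable {f : ℝ → ℝ}

lemma injOn_floor_cast {p : ℕ} (hf : Differentiable ℝ f) {K L M : ℝ}
    (hf1 : ∀ t ∈ Set.Icc K (K + L), 1 ≤ deriv f t ∧ deriv f t ≤ M) (hp : L * M + 1 < p) :
    Set.InjOn (fun n : ℤ => ((⌊f n⌋ : ℤ) : ZMod p)) (Ioc ⌊K⌋ ⌊K + L⌋ : Finset ℤ) := by
  have key : ∀ a ∈ Ioc ⌊K⌋ ⌊K + L⌋, ∀ b ∈ Ioc ⌊K⌋ ⌊K + L⌋, a < b →
      ((⌊f a⌋ : ℤ) : ZMod p) ≠ ((⌊f b⌋ : ℤ) : ZMod p) := by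
    intro a ha b hb hab heq
    rw [mem_Ioc, Int.floor_lt, Int.le_floor] at ha hb
    have hab' : (a : ℝ) + 1 ≤ b := by exact_mod_cast hab
    obtain ⟨c, hc, he⟩ := exists_deriv_mul_eq_sub hf (show (a : ℝ) ≤ b by linarith)
    have h1 := hf1 c ⟨by linarith [hc.1], by linarith [hc.2]⟩
    have hlow : f a + 1 ≤ f b := by nlinarith
    have hup : f b - f a ≤ L * M := by
      rw [he, mul_comm]
      exact mul_le_mul (by linarith) h1.2 (by linarith) (by linarith)
    have h2 : ⌊f a⌋ + 1 ≤ ⌊f b⌋ := by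
      rw [Int.le_floor]
      push_cast
      linarith [Int.floor_le (f a)]
    rw [ZMod.intCast_eq_intCast_iff_dvd_sub] at heq
    have h3 := Int.le_of_dvd (by linarith) heq
    have h4 : (p : ℝ) ≤ ⌊f b⌋ - ⌊f a⌋ := by exact_mod_cast h3
    linarith [Int.floor_le (f b), Int.lt_floor_add_one (f a)]
  intro a ha b hb hab
  by_contra hne
  rcases lt_or_gt_of_ne hne with h | h
  · exact key a (mem_coe.1 ha) b (mem_coe.1 hb) h hab
  · exact key b (mem_coe.1 hb) a (mem_coe.1 ha) h hab.symm

set_option maxHeartbeats 800000 in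
/-- The main estimate, with `X` playing the role of a small power of `K` and `Y` that of
`K ^ (κ / 2)`. -/
lemma norm_sum_psi_floor_le {p : ℕ} [Fact p.Prime] (x : ZMod p) {y : ZMod p} (hy : y ≠ 0)
    (hf : Differentiable ℝ f) (hf' : Differentiable ℝ (deriv f)) {K L X Y : ℝ} {J k : ℕ}
    (hX : 2 ≤ X) (hXY : X ^ 20 ≤ Y) (hYK : Y ^ 2 ≤ K) (hKp : K ≤ p) (hL1 : Y * X ^ 20 ≤ L)
    (hL2 : L * X ^ 20 ≤ Y ^ 2) (hk1 : 1 ≤ k) (hkp : k < p) (hJ : J ≤ 2 * X ^ 4)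
    (hpJ : p ≤ J ^ (2 * k))
    (hf1 : ∀ t ∈ Set.Icc K (2 * K), 1 ≤ deriv f t ∧ deriv f t ≤ 2 * K * X / Y ^ 2)
    (hf2 : ∀ t ∈ Set.Icc K (3 * K),
      1 / (9 * X * Y ^ 2) ≤ deriv (deriv f) t ∧ deriv (deriv f) t ≤ X / Y ^ 2) :
    ∃ A : ℝ, 0 ≤ A ∧ A ^ (2 * k) ≤ (2 * L) ^ (2 * k - 1) * (√p * (k ^ k + 6 * k)) ∧
      ‖∑ n ∈ Ioc ⌊K⌋ ⌊K + L⌋, psi p x y ((⌊f n⌋ : ℤ) : ZMod p)‖ ≤ A + 454 * (L / X ^ 5) := by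
  classical
  have hX0 : 0 < X := by linarith
  have hpow : ∀ {a b : ℕ}, a ≤ b → X ^ a ≤ X ^ b := fun h => pow_le_pow_right₀ (by linarith) h
  have hX1 : ∀ a : ℕ, 1 ≤ X ^ a := fun a => one_le_pow₀ (by linarith)
  have hY0 : 0 < Y := lt_of_lt_of_le (by positivity) hXY
  have hY1 : 1 ≤ Y := (hX1 20).trans hXY
  have hL0 : 0 < L := lt_of_lt_of_le (by positivity) hL1
  have hX5L : X ^ 20 ≤ L := le_trans (by nlinarith [hX1 20]) hL1
  have hLK : L ≤ K := by nlinarith [hX1 20]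
  have hK0 : 0 < K := hL0.trans_le hLK
  have hL1' : 1 ≤ L := (hX1 20).trans hX5L
  have hp0 : 0 < p := (Fact.out : p.Prime).pos
  have hJ0 : 0 < J := by
    rcases Nat.eq_zero_or_pos J with rfl | h
    · rw [zero_pow (by omega)] at hpJ
      omega
    · exact h
  have hJ1 : (1 : ℝ) ≤ J := by exact_mod_cast hJ0
  have hn0 : 0 < ⌊X ^ 10⌋₊ := Nat.floor_pos.2 (hX1 10)
  obtain ⟨h, hh0, hhn, hround⟩ := Real.exists_nat_abs_mul_sub_round_le (deriv f K) hn0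
  set m : ℤ := round ((h : ℝ) * deriv f K) with hm_def
  have hh1 : (1 : ℝ) ≤ h := by exact_mod_cast hh0
  have hhX : (h : ℝ) ≤ X ^ 10 :=
    (Nat.cast_le.2 hhn).trans (Nat.floor_le (by positivity))
  have hround' : |(h : ℝ) * deriv f K - m| ≤ 1 / X ^ 10 := by
    refine hround.trans (one_div_le_one_div_of_le (by positivity) (Nat.lt_floor_add_one _).le)
  have hτ : ∀ t ∈ Set.Icc K (K + 2 * L), |(h : ℝ) * deriv f t - m| ≤ 3 / X ^ 9 := by
    intro t ht
    obtain ⟨c, hc, he⟩ := exists_deriv_mul_eq_sub hf' ht.1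
    have h1 := hf2 c ⟨hc.1, by linarith [hc.2, ht.2]⟩
    have h2 : 0 ≤ deriv (deriv f) c := le_trans (by positivity) h1.1
    have h3 : |(h : ℝ) * deriv f t - h * deriv f K| ≤ X ^ 10 * (X / Y ^ 2 * (2 * L)) := by
      rw [← mul_sub, he, abs_of_nonneg (mul_nonneg (by positivity)
        (mul_nonneg h2 (by linarith [ht.1])))]
      refine mul_le_mul hhX ?_ (mul_nonneg h2 (by linarith [ht.1])) (by positivity)
      exact mul_le_mul h1.2 (by linarith [ht.2]) (by linarith [ht.1]) (by positivity)
    have h4 : X ^ 10 * (X / Y ^ 2 * (2 * L)) ≤ 2 / X ^ 9 := by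
      rw [le_div_iff₀ (by positivity), show X ^ 10 * (X / Y ^ 2 * (2 * L)) * X ^ 9 =
        2 * (L * X ^ 20 / Y ^ 2) by ring]
      have := (div_le_one (by positivity)).2 hL2
      linarith
    have h5 : 1 / X ^ 10 ≤ 1 / X ^ 9 := one_div_le_one_div_of_le (by positivity) (hpow (by norm_num))
    have h6 := abs_sub_le ((h : ℝ) * deriv f t) (h * deriv f K) m
    have h7 : 3 / X ^ 9 = 1 / X ^ 9 + 2 / X ^ 9 := by ring
    linarith
  have hfK := hf1 K ⟨le_rfl, by linarith⟩
  have hm1 : 1 ≤ m := by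
    have h1 := (abs_le.1 hround').2
    have h2 : 1 / X ^ 10 < 1 := by
      rw [div_lt_one (by positivity)]
      exact one_lt_pow₀ (by linarith) (by norm_num)
    have h3 : (0 : ℝ) < m := by
      have := mul_le_mul hh1 hfK.1 zero_le_one (by linarith)
      linarith
    exact_mod_cast h3
  have hX18 : 4 * X ^ 18 ≤ X ^ 20 := by
    have : 4 ≤ X ^ 2 := by nlinarith
    calc 4 * X ^ 18 ≤ X ^ 2 * X ^ 18 := by gcongr
      _ = X ^ 20 := by ring
  have hX20Y : X ^ 20 ≤ Y ^ 2 := hXY.trans (by nlinarith)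
  have hX2 : 4 ≤ X ^ 20 := by linarith [hX1 18]
  have hK4 : 4 ≤ K := by linarith
  have hmp : m < p := by
    have h1 := (abs_le.1 hround').1
    have h2 : 1 / X ^ 10 ≤ 1 := (div_le_one (by positivity)).2 (hX1 10)
    have h3 : (h : ℝ) * deriv f K ≤ X ^ 10 * (2 * K * X / Y ^ 2) :=
      mul_le_mul hhX hfK.2 (by linarith) (by positivity)
    have h4 : X ^ 10 * (2 * K * X / Y ^ 2) ≤ K / 2 := by
      rw [← mul_div_assoc, div_le_iff₀ (by positivity)]
      have h5 : 4 * X ^ 11 ≤ Y ^ 2 := by linarith [hpow (show 11 ≤ 18 by norm_num)]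
      calc X ^ 10 * (2 * K * X) = K / 2 * (4 * X ^ 11) := by ring
        _ ≤ K / 2 * Y ^ 2 := by gcongr
    have h5 : (m : ℝ) < p := by linarith
    exact_mod_cast h5
  have hmp0 : (m : ZMod p) ≠ 0 := by
    rw [Ne, ZMod.intCast_zmod_eq_zero_iff_dvd]
    intro h1
    have := Int.le_of_dvd (by omega) h1
    omega
  have hJp : J ≤ p := by
    have : (J : ℝ) ≤ p := by
      linarith [hpow (show 4 ≤ 18 by norm_num)]
    exact_mod_cast this
  have hJL : (h : ℝ) * J ≤ 2 * X ^ 14 := by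
    calc (h : ℝ) * J ≤ X ^ 10 * (2 * X ^ 4) := by gcongr
      _ = _ := by ring
  have hJτ : J * (3 / X ^ 9) ≤ 6 / X ^ 5 := by
    calc J * (3 / X ^ 9) ≤ 2 * X ^ 4 * (3 / X ^ 9) := by gcongr
      _ = 6 / X ^ 5 := by field_simp; norm_num
  obtain ⟨B, hB, hS⟩ := card_mul_norm_sum_psi_le x y hf hτ (δ := 6 / X ^ 5) (J := J)
    hJτ (by linarith [hpow (show 14 ≤ 18 by norm_num)])
    hJp hmp0
  set T := ⌈Y⌉₊ with hT
  have hT1 : Y ≤ T := Nat.le_ceil _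
  have hT2 : (T : ℝ) ≤ 2 * Y := by
    linarith [Nat.ceil_lt_add_one hY0.le]
  have hT0 : (0 : ℝ) < T := hY0.trans_le hT1
  have hhT : (h : ℝ) * T ≤ 2 * (X ^ 10 * Y) := by
    calc (h : ℝ) * T ≤ X ^ 10 * (2 * Y) := by gcongr
      _ = _ := by ring
  have hTL : (h : ℝ) * T ≤ L := by
    refine hhT.trans (le_trans ?_ hL1)
    have : 2 * X ^ 10 ≤ X ^ 20 := by linarith [hpow (show 10 ≤ 18 by norm_num), hX1 18]
    calc 2 * (X ^ 10 * Y) = Y * (2 * X ^ 10) := by ring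
      _ ≤ Y * X ^ 20 := by gcongr
  have hτδ : 3 / X ^ 9 ≤ 6 / X ^ 5 :=
    div_le_div₀ (by norm_num) (by norm_num) (by positivity) (hpow (by norm_num))
  have hδ : 2 * (6 / X ^ 5) ≤ 1 := by
    have : (2 : ℝ) ^ 5 ≤ X ^ 5 := by gcongr
    rw [← mul_div_assoc, div_le_one (by positivity)]
    linarith
  have hTLam : 1 ≤ (h : ℝ) ^ 2 * T ^ 2 * (X / Y ^ 2) := by
    calc (1 : ℝ) ≤ 1 ^ 2 * Y ^ 2 * (2 / Y ^ 2) := by field_simp; norm_num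
      _ ≤ _ := by gcongr
  have hbad := card_near_int_values_le hf hf' (T := T) (δ := 6 / X ^ 5) hL0.le hh0
    (lam := 1 / (9 * X * Y ^ 2)) (Lam := X / Y ^ 2) (by positivity)
    (fun t ht => hf2 t ⟨ht.1, by linarith [ht.2]⟩) (fun t ht => (hτ t ht).trans hτδ)
    hδ hTL hTLam
  set I := Ioc ⌊K⌋ ⌊K + L⌋ with hI
  have hcardI : (#I : ℝ) ≤ 2 * L := by
    have h1 : ⌊K⌋ ≤ ⌊K + L⌋ := Int.floor_mono (by linarith)
    have h2 : (#I : ℤ) = ⌊K + L⌋ - ⌊K⌋ := by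
      rw [hI, Int.card_Ioc]
      omega
    have h3 : (#I : ℝ) = ⌊K + L⌋ - ⌊K⌋ := by exact_mod_cast h2
    linarith [Int.floor_le (K + L), Int.lt_floor_add_one K]
  have hLM : L * (2 * K * X / Y ^ 2) + 1 < p := by
    have h1 : L * (2 * K * X / Y ^ 2) ≤ K / 2 := by
      rw [← mul_div_assoc, div_le_iff₀ (by positivity)]
      have h2 : 4 * X ≤ X ^ 20 := by linarith [hpow (show 1 ≤ 18 by norm_num), pow_one X]
      calc L * (2 * K * X) = K / 2 * (L * (4 * X)) := by ring
        _ ≤ K / 2 * (L * X ^ 20) := by gcongr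
        _ ≤ K / 2 * Y ^ 2 := by gcongr
    linarith
  have hinj := injOn_floor_cast (p := p) (L := L) hf (fun t ht => hf1 t ⟨ht.1, by linarith [ht.2]⟩)
    hLM
  have hA := sum_shifted_psi_pow_le x hy hk1 hkp B (by rwa [hB]) I _ hinj
  set A := ∑ n ∈ I, ‖∑ b ∈ B, psi p x y (((⌊f n⌋ : ℤ) : ZMod p) + b)‖ with hA_def
  refine ⟨A / J, by positivity, ?_, ?_⟩
  · rw [div_pow, div_le_iff₀ (by positivity)]
    rw [hB] at hA
    refine hA.trans ?_
    calc _ ≤ (2 * L) ^ (2 * k - 1) * ((J : ℝ) ^ (2 * k) * √p * (k ^ k + 6 * k)) := by gcongr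
      _ = _ := by ring
  · have hLX : ∀ {a : ℕ}, a ≤ 15 → Y * X ^ a ≤ L / X ^ 5 := by
      intro a ha
      rw [le_div_iff₀ (by positivity), mul_assoc, ← pow_add]
      refine le_trans ?_ hL1
      have := hpow (show a + 5 ≤ 20 by omega)
      gcongr
    set N := #{n ∈ I | ∃ k : ℤ, |f (n : ℤ) - k| ≤ 6 / X ^ 5} with hN
    have hN' : (N : ℝ) ≤ 225 * (L / X ^ 5) := by
      have h1 : 4 * h * T * (X / Y ^ 2) / (1 / (9 * X * Y ^ 2)) ≤ 72 * (L / X ^ 5) := by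
        calc 4 * h * T * (X / Y ^ 2) / (1 / (9 * X * Y ^ 2)) = 36 * X ^ 2 * (h * T) := by
              field_simp
              norm_num
          _ ≤ 36 * X ^ 2 * (2 * (X ^ 10 * Y)) := by gcongr
          _ = 72 * (Y * X ^ 12) := by ring
          _ ≤ 72 * (L / X ^ 5) := by
            gcongr
            exact hLX (by norm_num)
      have h2 : 1 ≤ L / X ^ 5 := by
        rw [one_le_div (by positivity)]
        exact (hpow (by norm_num)).trans hX5L
      have h3 : 2 / (T : ℝ) ≤ 2 / X ^ 5 :=
        div_le_div_of_nonneg_left (by norm_num) (by positivity)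
          ((hpow (by norm_num)).trans (hXY.trans hT1))
      have h4 : #I * (12 * (6 / X ^ 5) + 2 / T) ≤ 148 * (L / X ^ 5) := by
        calc #I * (12 * (6 / X ^ 5) + 2 / T) ≤ 2 * L * (12 * (6 / X ^ 5) + 2 / X ^ 5) := by gcongr
          _ = _ := by ring
      have h5 : 2 * (h : ℝ) * T ≤ 4 * (L / X ^ 5) := by
        calc 2 * (h : ℝ) * T = 2 * (h * T) := by ring
          _ ≤ 2 * (2 * (X ^ 10 * Y)) := by gcongr
          _ = 4 * (Y * X ^ 10) := by ring
          _ ≤ _ := by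
            gcongr
            exact hLX (by norm_num)
      linarith
    have hhJ : (h : ℝ) * J ≤ 2 * (L / X ^ 5) := by
      refine hJL.trans ?_
      gcongr
      refine le_trans ?_ (hLX (le_refl 15))
      nlinarith [hpow (show 14 ≤ 15 by norm_num), hX1 15]
    have hE : 2 * (h : ℝ) * J + 2 * N ≤ 454 * (L / X ^ 5) := by linarith
    rw [div_add' _ _ _ (by positivity), le_div_iff₀ (by positivity), mul_comm,
      mul_comm (454 * (L / X ^ 5))]
    exact hS.trans (add_le_add_right (mul_le_mul_of_nonneg_left hE (by positivity)) _)

end MainBound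

section Parameters

lemma one_le_of_one_le_rpow {K s : ℝ} (hs1 : 1 / 2 < s) (hs2 : s < 1) (h : 1 ≤ K ^ s) : 1 ≤ K := by
  by_contra! hK
  rcases lt_trichotomy K 0 with h0 | rfl | h0
  · rw [Real.rpow_def_of_neg h0] at h
    have hcos : Real.cos (s * Real.pi) < 0 :=
      Real.cos_neg_of_pi_div_two_lt_of_lt (by nlinarith [Real.pi_pos]) (by nlinarith [Real.pi_pos])
    nlinarith [Real.exp_pos (Real.log K * s)]
  · rw [Real.zero_rpow (by linarith)] at h
    norm_num at h
  · exact absurd h (not_le.2 (Real.rpow_lt_one h0.le hK (by linarith)))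

lemma norm_sum_psi_Ioc_le {p : ℕ} [Fact p.Prime] (x y : ZMod p) (u : ℤ → ZMod p) {K L : ℝ}
    (hL : 1 ≤ L) : ‖∑ n ∈ Ioc ⌊K⌋ ⌊K + L⌋, psi p x y (u n)‖ ≤ 2 * L := by
  refine (norm_sum_le_of_le (n := fun _ => 1) _ fun n _ => norm_psi_le_one x y (u n)).trans ?_
  have h1 : ⌊K⌋ ≤ ⌊K + L⌋ := Int.floor_mono (by linarith)
  have h2 : (#(Ioc ⌊K⌋ ⌊K + L⌋) : ℤ) = ⌊K + L⌋ - ⌊K⌋ := by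
    rw [Int.card_Ioc]
    omega
  have h3 : (#(Ioc ⌊K⌋ ⌊K + L⌋) : ℝ) = ⌊K + L⌋ - ⌊K⌋ := by exact_mod_cast h2
  rw [sum_const, nsmul_one, h3]
  linarith [Int.floor_le (K + L), Int.lt_floor_add_one K]

lemma le_of_pow_le_mul_sqrt {A L ε P c : ℝ} {k : ℕ} (hk1 : 1 ≤ k) (hε : 0 < ε) (hkε : k * ε ≤ 13)
    (hP : 1 ≤ P) (hPL : P ^ (1 / 2 + ε) ≤ L) (hc : 1 ≤ c)
    (hA : A ^ (2 * k) ≤ (2 * L) ^ (2 * k - 1) * (√P * c)) :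
    A ≤ 2 * c * (L * P ^ (-(ε ^ 2 / 26))) := by
  have hP0 : 0 < P := by linarith
  have hL0 : 0 < L := lt_of_lt_of_le (by positivity) hPL
  have hL : √P ≤ 2 * L * P ^ (-ε) := by
    calc √P = P ^ (1 / 2 + ε) * P ^ (-ε) := by
          rw [← Real.rpow_add hP0, Real.sqrt_eq_rpow]
          congr 1
          ring
      _ ≤ L * P ^ (-ε) := by gcongr
      _ ≤ 2 * L * P ^ (-ε) := by
        gcongr
        linarith
  have hPε : P ^ (-ε) ≤ (P ^ (-(ε ^ 2 / 26))) ^ (2 * k) := by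
    rw [← Real.rpow_natCast, ← Real.rpow_mul hP0.le]
    refine Real.rpow_le_rpow_of_exponent_le hP ?_
    push_cast
    nlinarith
  refine le_of_pow_le_pow_left₀ (n := 2 * k) (by omega) (by positivity) ?_
  calc A ^ (2 * k) ≤ (2 * L) ^ (2 * k - 1) * (2 * L * P ^ (-ε) * c) := hA.trans (by gcongr)
    _ = (2 * L) ^ (2 * k) * c * P ^ (-ε) := by
      rw [← mul_assoc, ← mul_assoc, ← pow_succ, Nat.sub_add_cancel (by omega)]
      ring
    _ ≤ (2 * L) ^ (2 * k) * c ^ (2 * k) * (P ^ (-(ε ^ 2 / 26))) ^ (2 * k) := by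
      have := le_self_pow₀ hc (show 2 * k ≠ 0 by omega)
      gcongr
    _ = _ := by ring

end Parameters

end

theorem stmt_4 (κ : ℝ) (hκ₁ : 2 / 3 < κ) (hκ₂ : κ < 1) (f : ℝ → ℝ)
    (hf : Differentiable ℝ f) (hf' : Differentiable ℝ (deriv f))
    (hpos : ∀ᶠ t in Filter.atTop, 0 < deriv (deriv f) t)
    (hlim : Filter.Tendsto (fun t => Real.log (deriv (deriv f) t) / Real.log t)
      Filter.atTop (nhds (-κ))) :
    ∃ ε₀ > (0 : ℝ), ∀ ε : ℝ, 0 < ε → ε ≤ ε₀ → ∃ C > (0 : ℝ), ∀ p : ℕ, p.Prime →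
      ∀ x y : ZMod p, y ≠ 0 → ∀ K L : ℝ,
        L ≤ K ^ (κ - ε) → K ^ (κ / 2) * (p : ℝ) ^ ε ≤ L →
        K ≤ (p : ℝ) ^ (1 / (2 - κ)) → (p : ℝ) ^ (1 / 2 + ε) ≤ L →
        ‖∑ n ∈ Finset.Ioc ⌊K⌋ ⌊K + L⌋, psi p x y ((⌊f n⌋ : ℤ) : ZMod p)‖ ≤
          C * L * (p : ℝ) ^ (-(ε ^ 2 / 26)) := by
  refine ⟨1 / 10, by norm_num, fun ε hε hε10 => ?_⟩
  have hη : 0 < ε / 20 := by positivity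
  obtain ⟨K₁, hK₁⟩ := Filter.eventually_atTop.1
    ((eventually_rpow_le_deriv_deriv hpos hlim hη).and
      ((eventually_deriv_le_rpow hκ₂ hf' hpos hlim hη).and
        (((tendsto_deriv_atTop hκ₂ hf' hpos hlim).eventually_ge_atTop 1).and
          ((tendsto_rpow_atTop hη).eventually_ge_atTop 2))))
  set k := ⌈5 / ε⌉₊ with hk
  have hk1 : 1 ≤ k := Nat.one_le_iff_ne_zero.2 (Nat.ceil_pos.2 (by positivity)).ne'
  have hkε1 : 5 ≤ k * ε := (div_le_iff₀ hε).1 (Nat.le_ceil _)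
  have hkε2 : k * ε ≤ 13 := by
    have h1 := Nat.ceil_lt_add_one (show 0 ≤ 5 / ε by positivity)
    have h2 : (5 / ε + 1) * ε = 5 + ε := by field_simp
    nlinarith
  have hc1 : (1 : ℝ) ≤ (k : ℝ) ^ k + 6 * k := by
    have : (1 : ℝ) ≤ k := by exact_mod_cast hk1
    have := one_le_pow₀ this (n := k)
    linarith
  set P₀ : ℝ := max 1 K₁ ^ 2 + k + 1 with hP₀
  have hP₀0 : 0 < P₀ := by positivity
  refine ⟨2 * ((k : ℝ) ^ k + 6 * k) + 454 + 2 * P₀ ^ (ε ^ 2 / 26), by positivity, ?_⟩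
  intro p hp x y hy K L hLK hKL hKp hpL
  have : Fact p.Prime := ⟨hp⟩
  have hp1 : (1 : ℝ) ≤ p := by exact_mod_cast hp.one_lt.le
  have hp0 : (0 : ℝ) < p := by linarith
  have hL1 : 1 ≤ L := (Real.one_le_rpow hp1 (by positivity)).trans hpL
  have hK1 : 1 ≤ K := one_le_of_one_le_rpow (by linarith) (by linarith) (hL1.trans hLK)
  have hK0 : 0 < K := by linarith
  set Q := (p : ℝ) ^ (-(ε ^ 2 / 26)) with hQ
  have hQ0 : 0 < Q := by positivity
  rcases lt_or_ge (p : ℝ) P₀ with hpP | hpP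
  · have h1 : 1 ≤ P₀ ^ (ε ^ 2 / 26) * Q := by
      rw [hQ, Real.rpow_neg hp0.le, ← div_eq_mul_inv, one_le_div (by positivity)]
      gcongr
    calc _ ≤ 2 * L := norm_sum_psi_Ioc_le x y _ hL1
      _ ≤ 2 * L * (P₀ ^ (ε ^ 2 / 26) * Q) := le_mul_of_one_le_right (by positivity) h1
      _ = 2 * P₀ ^ (ε ^ 2 / 26) * L * Q := by ring
      _ ≤ _ := by
        gcongr
        have : 0 ≤ 2 * ((k : ℝ) ^ k + 6 * k) + 454 := by positivity
        linarith
  have hpK : (p : ℝ) ≤ K ^ 2 := by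
    have h1 : (p : ℝ) ^ (1 / 2 : ℝ) ≤ K := by
      calc (p : ℝ) ^ (1 / 2 : ℝ) ≤ (p : ℝ) ^ (1 / 2 + ε) :=
            Real.rpow_le_rpow_of_exponent_le hp1 (by linarith)
        _ ≤ K ^ (κ - ε) := hpL.trans hLK
        _ ≤ K ^ (1 : ℝ) := Real.rpow_le_rpow_of_exponent_le hK1 (by linarith)
        _ = K := Real.rpow_one K
    rw [← Real.sqrt_eq_rpow, Real.sqrt_le_left hK0.le] at h1
    exact h1
  have hKK₁ : max 1 K₁ ≤ K := by
    have h1 : max 1 K₁ ^ 2 ≤ K ^ 2 := by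
      have : (0 : ℝ) ≤ k := by positivity
      linarith
    exact le_of_pow_le_pow_left₀ two_ne_zero hK0.le h1
  have hK₁K : K₁ ≤ K := (le_max_right _ _).trans hKK₁
  have hkp : k < p := by
    have h1 : (k : ℝ) < p := by
      have : (0 : ℝ) ≤ max 1 K₁ ^ 2 := by positivity
      linarith
    exact_mod_cast h1
  have hKp' : K ≤ p := by
    refine hKp.trans ((Real.rpow_le_rpow_of_exponent_le hp1 ?_).trans_eq (Real.rpow_one _))
    rw [div_le_one (by linarith)]
    linarith
  have hXpow : ∀ a : ℕ, (K ^ (ε / 20)) ^ a = K ^ (ε * a / 20) := by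
    intro a
    rw [← Real.rpow_natCast, ← Real.rpow_mul hK0.le]
    congr 1
    ring
  have hY2 : (K ^ (κ / 2)) ^ 2 = K ^ κ := by
    rw [← Real.rpow_natCast, ← Real.rpow_mul hK0.le]
    congr 1
    push_cast
    ring
  have hX20 : (K ^ (ε / 20)) ^ 20 = K ^ ε := by
    rw [hXpow]
    congr 1
    push_cast
    ring
  have hXY : K ^ (ε / 20) / (K ^ (κ / 2)) ^ 2 = K ^ (-κ + ε / 20) := by
    rw [hY2, ← Real.rpow_sub hK0]
    congr 1
    ring
  have hpow_pK : ∀ a : ℝ, 0 ≤ a → (p : ℝ) ^ a ≤ K ^ (2 * a) := by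
    intro a ha
    rw [Real.rpow_mul hK0.le, Real.rpow_two]
    gcongr
  have hXY20 : (K ^ (ε / 20)) ^ 20 ≤ K ^ (κ / 2) := by
    rw [hX20]
    exact Real.rpow_le_rpow_of_exponent_le hK1 (by linarith)
  have hYK : (K ^ (κ / 2)) ^ 2 ≤ K := by
    rw [hY2]
    exact (Real.rpow_le_rpow_of_exponent_le hK1 hκ₂.le).trans_eq (Real.rpow_one K)
  have hYXL : K ^ (κ / 2) * (K ^ (ε / 20)) ^ 20 ≤ L := by
    rw [hX20]
    refine le_trans ?_ hKL
    gcongr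
  have hLXY : L * (K ^ (ε / 20)) ^ 20 ≤ (K ^ (κ / 2)) ^ 2 := by
    rw [hX20, hY2]
    calc L * K ^ ε ≤ K ^ (κ - ε) * K ^ ε := by gcongr
      _ = K ^ κ := by rw [← Real.rpow_add hK0, sub_add_cancel]
  have hJ : (⌈(p : ℝ) ^ (ε / 10)⌉₊ : ℝ) ≤ 2 * (K ^ (ε / 20)) ^ 4 := by
    have h1 : 1 ≤ (p : ℝ) ^ (ε / 10) := Real.one_le_rpow hp1 (by positivity)
    have h2 := Nat.ceil_lt_add_one (show 0 ≤ (p : ℝ) ^ (ε / 10) by positivity)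
    have h3 := hpow_pK (ε / 10) (by positivity)
    rw [hXpow]
    rw [show ε * (4 : ℕ) / 20 = 2 * (ε / 10) by push_cast; ring]
    linarith
  have hpJ : p ≤ ⌈(p : ℝ) ^ (ε / 10)⌉₊ ^ (2 * k) := by
    have h1 : (p : ℝ) ≤ (⌈(p : ℝ) ^ (ε / 10)⌉₊ : ℝ) ^ (2 * k) := by
      calc (p : ℝ) = (p : ℝ) ^ (1 : ℝ) := (Real.rpow_one _).symm
        _ ≤ (p : ℝ) ^ (ε / 10 * (2 * k : ℕ)) := by
          refine Real.rpow_le_rpow_of_exponent_le hp1 ?_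
          push_cast
          linarith
        _ = ((p : ℝ) ^ (ε / 10)) ^ (2 * k) := by
          rw [Real.rpow_mul hp0.le, Real.rpow_natCast]
        _ ≤ _ := by
          gcongr
          exact Nat.le_ceil _
    exact_mod_cast h1
  have hf1 : ∀ t ∈ Set.Icc K (2 * K), 1 ≤ deriv f t ∧
      deriv f t ≤ 2 * K * K ^ (ε / 20) / (K ^ (κ / 2)) ^ 2 := by
    intro t ht
    have h1 := hK₁ t (hK₁K.trans ht.1)
    refine ⟨h1.2.2.1, h1.2.1.trans ?_⟩
    have ht0 : 0 < t := hK0.trans_le ht.1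
    calc t ^ (1 - κ + ε / 20) ≤ (2 * K) ^ (1 - κ + ε / 20) :=
          Real.rpow_le_rpow ht0.le ht.2 (by linarith)
      _ = 2 ^ (1 - κ + ε / 20) * (K * K ^ (-κ + ε / 20)) := by
        rw [Real.mul_rpow zero_le_two hK0.le, add_comm_sub, add_comm (-κ), ← add_sub_assoc,
          add_sub_assoc, Real.rpow_add hK0, Real.rpow_one]
        ring_nf
      _ ≤ 2 ^ (1 : ℝ) * (K * K ^ (-κ + ε / 20)) := by
        gcongr
        · norm_num
        · linarith
      _ = _ := by
        rw [← hXY, Real.rpow_one]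
        ring
  have hf2 : ∀ t ∈ Set.Icc K (3 * K), 1 / (9 * K ^ (ε / 20) * (K ^ (κ / 2)) ^ 2) ≤ deriv (deriv f) t ∧
      deriv (deriv f) t ≤ K ^ (ε / 20) / (K ^ (κ / 2)) ^ 2 := by
    intro t ht
    have h1 := (hK₁ t (hK₁K.trans ht.1)).1
    have ht0 : 0 < t := hK0.trans_le ht.1
    refine ⟨le_trans ?_ h1.1, h1.2.trans ?_⟩
    · calc 1 / (9 * K ^ (ε / 20) * (K ^ (κ / 2)) ^ 2) = 3 ^ (-2 : ℝ) * K ^ (-κ - ε / 20) := by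
            rw [hY2, Real.rpow_sub hK0, Real.rpow_neg hK0.le, Real.rpow_neg (by norm_num),
              Real.rpow_two]
            field_simp
            norm_num
        _ ≤ 3 ^ (-κ - ε / 20) * K ^ (-κ - ε / 20) := by
          gcongr
          · norm_num
          · linarith
        _ = (3 * K) ^ (-κ - ε / 20) := (Real.mul_rpow (by norm_num) hK0.le).symm
        _ ≤ t ^ (-κ - ε / 20) := Real.rpow_le_rpow_of_nonpos ht0 ht.2 (by linarith)
    · rw [hXY]
      exact Real.rpow_le_rpow_of_nonpos hK0 ht.1 (by linarith)
  obtain ⟨A, hA0, hA, hS⟩ := norm_sum_psi_floor_le x hy hf hf' (hK₁ K hK₁K).2.2.2 hXY20 hYK hKp'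
    hYXL hLXY hk1 hkp hJ hpJ hf1 hf2
  have hA' := le_of_pow_le_mul_sqrt hk1 hε hkε2 hp1 hpL hc1 hA
  have h1 : L / (K ^ (ε / 20)) ^ 5 ≤ L * Q := by
    rw [div_eq_mul_inv, hQ, Real.rpow_neg hp0.le, hXpow]
    gcongr
    refine (hpow_pK _ (by positivity)).trans (Real.rpow_le_rpow_of_exponent_le hK1 ?_)
    push_cast
    nlinarith
  calc _ ≤ 2 * ((k : ℝ) ^ k + 6 * k) * (L * Q) + 454 * (L * Q) := by linarith
    _ = (2 * ((k : ℝ) ^ k + 6 * k) + 454) * L * Q := by ring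
    _ ≤ _ := by
      have : 0 ≤ 2 * P₀ ^ (ε ^ 2 / 26) * L * Q := by positivity
      linarith
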